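/- arXiv:1203.5145 — 7 statements merged into one kernel-verified Lean document; each statement's English description precedes it below -/
import Mathlib

section
/- Let m ≥ 2 and N ≥ 2 be integers and suppose N is not a multiple of m. Then for every permutation σ of ℤ/Nℤ, the composite map g = σ ∘ f : [0,1) → [0,1) is topologically mixing. -/
open Set

noncomputable def fract01 (y : ℝ) : Set.Ico (0:ℝ) 1 :=
  ⟨Int.fract y, Int.fract_nonneg y, Int.fract_lt_one y⟩

/-- The map `f(x) = m x mod 1` on `[0,1)`. -/
noncomputable def mulMap (m : ℕ) (x : Set.Ico (0:ℝ) 1) : Set.Ico (0:ℝ) 1 :=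
  fract01 (m * x.val)

/-- The interval exchange map on `[0,1)` induced by a permutation `σ` of `ℤ/Nℤ`,
permuting the `N` subintervals `I_j = [j/N, (j+1)/N)`. -/
noncomputable def permMap (N : ℕ) (σ : Equiv.Perm (ZMod N)) (x : Set.Ico (0:ℝ) 1) :
    Set.Ico (0:ℝ) 1 :=
  fract01 (x.val +
    (((σ ((⌊(N : ℝ) * x.val⌋ : ℤ) : ZMod N)).val : ℝ) -
      (((⌊(N : ℝ) * x.val⌋ : ℤ) : ZMod N)).val) / N)

/-- Topological mixing of a self-map of a topological space. -/
def TopMixing {X : Type*} [TopologicalSpace X] (g : X → X) : Prop :=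
  ∀ U V : Set X, IsOpen U → IsOpen V → U.Nonempty → V.Nonempty →
    ∃ n₀ : ℕ, ∀ n ≥ n₀, (g^[n] '' U ∩ V).Nonempty

/-- The subinterval `I_j = [j/N, (j+1)/N)` of `[0,1)`. -/
def Isub (N : ℕ) (j : ZMod N) : Set (Set.Ico (0:ℝ) 1) :=
  {x | (j.val : ℝ) / N ≤ x.val ∧ x.val < ((j.val : ℝ) + 1) / N}

/-- `f̃(A) = {m·a + d : a ∈ A, 0 ≤ d ≤ m−1} ⊆ ℤ/Nℤ`. -/
def ftil (m N : ℕ) (A : Set (ZMod N)) : Set (ZMod N) :=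
  {b | ∃ a ∈ A, ∃ d : ℕ, d < m ∧ b = (m : ZMod N) * a + (d : ZMod N)}

/-- The arrows `a → m·a + d` with `0 ≤ d < m`, followed by `σ`, on finite sets of residues. -/
def transitionImage (m N : ℕ) (σ : Equiv.Perm (ZMod N)) (A : Finset (ZMod N)) :
    Finset (ZMod N) :=
  (A ×ˢ Finset.range m).image fun p => σ ((m : ZMod N) * p.1 + (p.2 : ZMod N))

/-- Every residue `b` is hit by exactly `m` pairs `(a, d)` under `(a, d) ↦ m·a + d`. -/
theorem card_filter_mul_add_mem (m N : ℕ) [NeZero N] (B : Finset (ZMod N)) :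
    ((Finset.univ ×ˢ Finset.range m : Finset (ZMod N × ℕ)).filter
      fun p => (m : ZMod N) * p.1 + (p.2 : ZMod N) ∈ B).card = m * B.card := by
  conv_rhs => rw [← Finset.card_range m, ← Finset.card_product]
  have hN : 0 < N := Nat.pos_of_ne_zero (NeZero.ne N)
  refine Finset.card_nbij'
    (fun p => ((m * p.1.val + p.2) / N, (m : ZMod N) * p.1 + (p.2 : ZMod N)))
    (fun q => (((N * q.1 + q.2.val) / m : ℕ), (N * q.1 + q.2.val) % m)) ?_ ?_ ?_ ?_
  · rintro ⟨a, d⟩ h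
    simp only [Finset.coe_filter, Finset.mem_product, Finset.mem_univ, Finset.mem_range,
      true_and, Set.mem_ofPred_eq] at h
    simp only [Finset.coe_product, Set.mem_prod, Finset.mem_coe, Finset.mem_range]
    refine ⟨?_, h.2⟩
    rw [Nat.div_lt_iff_lt_mul hN]
    have := ZMod.val_lt a
    nlinarith [h.1]
  · rintro ⟨c, b⟩ h
    simp only [Finset.coe_product, Set.mem_prod, Finset.mem_coe, Finset.mem_range] at h
    simp only [Finset.coe_filter, Finset.mem_product, Finset.mem_univ, Finset.mem_range,
      true_and, Set.mem_ofPred_eq]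
    refine ⟨Nat.mod_lt _ (by omega), ?_⟩
    have e : (m : ZMod N) * ((N * c + b.val) / m : ℕ) + ((N * c + b.val) % m : ℕ) = b := by
      rw [← Nat.cast_mul, ← Nat.cast_add, Nat.div_add_mod]
      simp
    rw [e]
    exact h.2
  · rintro ⟨a, d⟩ h
    simp only [Finset.coe_filter, Finset.mem_product, Finset.mem_univ, Finset.mem_range,
      true_and, Set.mem_ofPred_eq] at h
    have e : ((m : ZMod N) * a + (d : ZMod N)).val = (m * a.val + d) % N := by
      rw [← ZMod.val_natCast]
      simp
    have hm : 0 < m := by omega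
    simp only [e, Nat.div_add_mod, Nat.mul_add_div hm, Nat.mul_add_mod, Nat.div_eq_of_lt h.1,
      Nat.mod_eq_of_lt h.1, add_zero, ZMod.natCast_zmod_val]
  · rintro ⟨c, b⟩ h
    simp only [Finset.coe_product, Set.mem_prod, Finset.mem_coe, Finset.mem_range] at h
    have hb := ZMod.val_lt b
    have hlt : (N * c + b.val) / m < N := by
      rw [Nat.div_lt_iff_lt_mul (by omega)]
      nlinarith [h.1]
    have e : (m : ZMod N) * ((N * c + b.val) / m : ℕ) + ((N * c + b.val) % m : ℕ) = b := by
      rw [← Nat.cast_mul, ← Nat.cast_add, Nat.div_add_mod]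
      simp
    simp only [e, ZMod.val_natCast, Nat.mod_eq_of_lt hlt, Nat.div_add_mod,
      Nat.mul_add_div hN, Nat.div_eq_of_lt hb, add_zero]

/-- If `m ∤ N`, the transition strictly enlarges every proper nonempty set of residues. -/
theorem card_lt_card_transitionImage (m N : ℕ) [NeZero N] (hm : 0 < m) (hnd : ¬ m ∣ N)
    (σ : Equiv.Perm (ZMod N)) {A : Finset (ZMod N)} (hA : A.Nonempty) (hA' : A ≠ Finset.univ) :
    A.card < (transitionImage m N σ A).card := by
  by_contra! hle
  set B := (A ×ˢ Finset.range m).image fun p => (m : ZMod N) * p.1 + (p.2 : ZMod N) with hB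
  have hcard : (transitionImage m N σ A).card = B.card := by
    rw [← Finset.card_image_of_injective B σ.injective, hB, Finset.image_image]
    rfl
  rw [hcard] at hle
  have hsub : A ×ˢ Finset.range m ⊆ (Finset.univ ×ˢ Finset.range m).filter
      fun p => (m : ZMod N) * p.1 + (p.2 : ZMod N) ∈ B := by
    intro p hp
    have hp' := Finset.mem_product.1 hp
    exact Finset.mem_filter.2 ⟨Finset.mem_product.2 ⟨Finset.mem_univ _, hp'.2⟩,
      Finset.mem_image_of_mem _ hp⟩
  have heq := Finset.eq_of_subset_of_card_le hsub (by
    rw [card_filter_mul_add_mem, Finset.card_product, Finset.card_range, mul_comm]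
    exact Nat.mul_le_mul_right _ hle)
  have hback : ∀ a : ZMod N, ∀ d < m, (m : ZMod N) * a + (d : ZMod N) ∈ B → a ∈ A := by
    intro a d hd h
    have : (a, d) ∈ A ×ˢ Finset.range m := by
      rw [heq]
      exact Finset.mem_filter.2
        ⟨Finset.mk_mem_product (Finset.mem_univ _) (Finset.mem_range.2 hd), h⟩
    exact (Finset.mem_product.1 this).1
  have hfwd : ∀ a ∈ A, ∀ d < m, (m : ZMod N) * a + (d : ZMod N) ∈ B := fun a ha d hd =>
    Finset.mem_image_of_mem (fun p : ZMod N × ℕ => (m : ZMod N) * p.1 + (p.2 : ZMod N))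
      (Finset.mk_mem_product ha (Finset.mem_range.2 hd))
  have hgpos : 0 < m.gcd N := Nat.gcd_pos_of_pos_left _ hm
  have hglt : m.gcd N < m := lt_of_le_of_ne (Nat.gcd_le_left _ hm)
    fun h => hnd (Nat.gcd_eq_left_iff_dvd.1 h)
  obtain ⟨u, hu⟩ : ∃ u : ZMod N, (m : ZMod N) * u = (m.gcd N : ℕ) := by
    refine ⟨(m.gcdA N : ℤ), ?_⟩
    have := congrArg (Int.cast : ℤ → ZMod N) (Nat.gcd_eq_gcd_ab m N)
    push_cast at this
    simpa using this.symm
  have hsucc : ∀ b ∈ B, b + 1 ∈ B := by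
    intro b hb
    obtain ⟨⟨a, d⟩, hp, rfl⟩ := Finset.mem_image.1 hb
    obtain ⟨ha, hd⟩ := Finset.mem_product.1 hp
    dsimp only at ha hd hb ⊢
    rw [Finset.mem_range] at hd
    rcases Nat.lt_or_ge (d + 1) m with h | h
    · have := hfwd a ha (d + 1) h
      push_cast at this
      rwa [← add_assoc] at this
    · obtain ⟨e, he⟩ : ∃ e, d = e + m.gcd N := ⟨d - m.gcd N, by omega⟩
      have h1 : (m : ZMod N) * a + (d : ZMod N) = (m : ZMod N) * (a + u) + (e : ZMod N) := by
        rw [mul_add, hu, he]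
        push_cast
        ring
      have ha' : a + u ∈ A := hback (a + u) e (by omega) (h1 ▸ hb)
      have := hfwd _ ha' (e + 1) (by omega)
      push_cast at this
      rwa [h1, add_assoc]
  obtain ⟨a, ha⟩ := hA
  have hall : ∀ n : ℕ, (m : ZMod N) * a + (n : ZMod N) ∈ B := by
    intro n
    induction n with
    | zero => exact hfwd a ha 0 hm
    | succ n ih =>
      have := hsucc _ ih
      push_cast
      rwa [← add_assoc]
  refine hA' (Finset.eq_univ_iff_forall.2 fun x => hback x 0 hm ?_)
  have := hall ((m : ZMod N) * x - m * a).val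
  rw [ZMod.natCast_zmod_val, add_sub_cancel] at this
  rwa [Nat.cast_zero, add_zero]

theorem transitionImage_univ (m N : ℕ) [NeZero N] (hm : 0 < m) (σ : Equiv.Perm (ZMod N)) :
    transitionImage m N σ Finset.univ = Finset.univ := by
  refine Finset.eq_univ_iff_forall.2 fun b => Finset.mem_image.2 ?_
  refine ⟨(((σ.symm b).val / m : ℕ), (σ.symm b).val % m), ?_, ?_⟩
  · simp [Nat.mod_lt _ hm]
  · dsimp only
    rw [← Nat.cast_mul, ← Nat.cast_add, Nat.div_add_mod, ZMod.natCast_zmod_val,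
      Equiv.apply_symm_apply]

theorem iterate_transitionImage_eq_univ (m N : ℕ) [NeZero N] (hm : 0 < m) (hnd : ¬ m ∣ N)
    (σ : Equiv.Perm (ZMod N)) {A : Finset (ZMod N)} (hA : A.Nonempty) {n : ℕ} (hn : N ≤ n) :
    (transitionImage m N σ)^[n] A = Finset.univ := by
  have key : ∀ n, (transitionImage m N σ)^[n] A = Finset.univ ∨
      n < ((transitionImage m N σ)^[n] A).card := by
    intro n
    induction n with
    | zero => exact Or.inr hA.card_pos
    | succ n ih =>
      rw [Function.iterate_succ_apply']
      by_cases h : (transitionImage m N σ)^[n] A = Finset.univ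
      · left
        rw [h, transitionImage_univ m N hm]
      · right
        have h1 := ih.resolve_left h
        have := card_lt_card_transitionImage m N hm hnd σ
          (Finset.card_pos.1 (by omega)) h
        omega
  refine (key n).resolve_right fun h => ?_
  have := Finset.card_le_univ ((transitionImage m N σ)^[n] A)
  rw [ZMod.card] at this
  omega

theorem natCast_mul_permMap_mulMap (m N : ℕ) [NeZero N] (σ : Equiv.Perm (ZMod N))
    (x : Set.Ico (0 : ℝ) 1) :
    (N : ℝ) * (permMap N σ (mulMap m x)).val =
      (σ ((⌊(N : ℝ) * m * x.val⌋ : ℤ) : ZMod N)).val + Int.fract ((N : ℝ) * m * x.val) := by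
  have hN : (0 : ℝ) < N := Nat.cast_pos.2 (Nat.pos_of_ne_zero (NeZero.ne N))
  have hy0 : 0 ≤ Int.fract (m * x.val) := Int.fract_nonneg _
  have hy1 : Int.fract (m * x.val) < 1 := Int.fract_lt_one _
  have e : (N : ℝ) * Int.fract (m * x.val) =
      N * m * x.val - ((N * ⌊(m : ℝ) * x.val⌋ : ℤ) : ℝ) := by
    rw [← Int.self_sub_floor]
    push_cast
    ring
  have hcast : ((⌊(N : ℝ) * Int.fract (m * x.val)⌋ : ℤ) : ZMod N) =
      ((⌊(N : ℝ) * m * x.val⌋ : ℤ) : ZMod N) := by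
    rw [e, Int.floor_sub_intCast]
    push_cast
    simp
  have hfract : Int.fract ((N : ℝ) * Int.fract (m * x.val)) = Int.fract ((N : ℝ) * m * x.val) := by
    rw [e, Int.fract_sub_intCast]
  have hval : ((((⌊(N : ℝ) * Int.fract (m * x.val)⌋ : ℤ) : ZMod N).val : ℤ) : ℝ) =
      ⌊(N : ℝ) * Int.fract (m * x.val)⌋ := by
    rw [ZMod.val_intCast, Int.emod_eq_of_lt (Int.floor_nonneg.2 (by positivity))]
    rw [Int.floor_lt]
    push_cast
    nlinarith
  rw [Int.cast_natCast] at hval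
  simp only [permMap, mulMap, fract01]
  rw [hval, hcast]
  set s := (σ ((⌊(N : ℝ) * m * x.val⌋ : ℤ) : ZMod N)).val with hs
  have hsN : (s : ℝ) + 1 ≤ N := by exact_mod_cast ZMod.val_lt _
  have hfr0 := Int.fract_nonneg ((N : ℝ) * m * x.val)
  have hfr1 := Int.fract_lt_one ((N : ℝ) * m * x.val)
  have e2 : Int.fract (m * x.val) + ((s : ℝ) - ⌊(N : ℝ) * Int.fract (m * x.val)⌋) / N =
      (s + Int.fract ((N : ℝ) * m * x.val)) / N := by
    rw [← hfract, ← Int.self_sub_floor ((N : ℝ) * Int.fract (m * x.val))]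
    field_simp
    ring
  rw [e2, Int.fract_eq_self.2 ⟨by positivity, by rw [div_lt_one hN]; linarith⟩]
  field_simp

/-- The cylinder `[k / (N m ^ n), (k + 1) / (N m ^ n))`. -/
def cylinder (m N n k : ℕ) : Set (Set.Ico (0 : ℝ) 1) :=
  {x | (k : ℝ) ≤ N * m ^ n * x.val ∧ N * m ^ n * x.val < k + 1}

/-- The map sends a cylinder of level `n + 1` onto one of level `n`. -/
theorem exists_mem_cylinder_succ (m N : ℕ) [NeZero N] (hm : 0 < m) (σ : Equiv.Perm (ZMod N))
    {n k : ℕ} (hk : k < N * m ^ (n + 1)) {y : Set.Ico (0 : ℝ) 1}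
    (hy : y ∈ cylinder m N n ((σ ((k / m ^ n : ℕ) : ZMod N)).val * m ^ n + k % m ^ n)) :
    ∃ x ∈ cylinder m N (n + 1) k, permMap N σ (mulMap m x) = y := by
  have hN : (0 : ℝ) < N := Nat.cast_pos.2 (Nat.pos_of_ne_zero (NeZero.ne N))
  have hm' : (0 : ℝ) < m := Nat.cast_pos.2 hm
  have hkR : (k : ℝ) + 1 ≤ N * m ^ (n + 1) := by exact_mod_cast hk
  obtain ⟨hy0, hy1⟩ := hy
  push_cast at hy0 hy1
  set s := (σ ((k / m ^ n : ℕ) : ZMod N)).val with hs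
  set r := k % m ^ n with hr
  obtain ⟨t, ht⟩ : ∃ t : ℝ, N * m ^ n * y.val = s * m ^ n + r + t :=
    ⟨N * m ^ n * y.val - (s * m ^ n + r), by ring⟩
  have ht0 : 0 ≤ t := by linarith
  have ht1 : t < 1 := by linarith
  have hP : (0 : ℝ) < N * m ^ (n + 1) := by positivity
  have hMn : (0 : ℝ) < m ^ n := by positivity
  have hx : ((k : ℝ) + t) / (N * m ^ (n + 1)) ∈ Set.Ico (0 : ℝ) 1 :=
    ⟨by positivity, by rw [div_lt_one hP]; linarith⟩
  have hxe : (N : ℝ) * m ^ (n + 1) * (((k : ℝ) + t) / (N * m ^ (n + 1))) = k + t := by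
    field_simp
  refine ⟨⟨_, hx⟩, ⟨?_, ?_⟩, ?_⟩
  · rw [hxe]; linarith
  · rw [hxe]; linarith
  apply Subtype.ext
  apply mul_left_cancel₀ hN.ne'
  rw [natCast_mul_permMap_mulMap]
  dsimp only
  have hrlt : (r : ℝ) + 1 ≤ m ^ n := by exact_mod_cast Nat.mod_lt k (pow_pos hm n)
  have hdm : (k : ℝ) = m ^ n * (k / m ^ n : ℕ) + r := by
    exact_mod_cast (Nat.div_add_mod k (m ^ n)).symm
  have e : (N : ℝ) * m * (((k : ℝ) + t) / (N * m ^ (n + 1))) =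
      (r + t) / m ^ n + (((k / m ^ n : ℕ) : ℤ) : ℝ) := by
    rw [Int.cast_natCast, pow_succ]
    field_simp
    linarith
  have hfl : (0 : ℝ) ≤ (r + t) / m ^ n ∧ ((r : ℝ) + t) / m ^ n < 1 :=
    ⟨by positivity, by rw [div_lt_one hMn]; linarith⟩
  rw [e, Int.floor_add_intCast, Int.fract_add_intCast, Int.fract_eq_self.2 hfl,
    Int.floor_eq_zero_iff.2 hfl, zero_add, Int.cast_natCast, ← hs]
  field_simp
  linarith

theorem exists_cylinder_zero_subset_image (m N : ℕ) [NeZero N] (hm : 0 < m)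
    (σ : Equiv.Perm (ZMod N)) {n k : ℕ} (hk : k < N * m ^ n) :
    ∃ j : ZMod N, cylinder m N 0 j.val ⊆
      (fun x => permMap N σ (mulMap m x))^[n] '' cylinder m N n k := by
  induction n generalizing k with
  | zero =>
    refine ⟨(k : ZMod N), ?_⟩
    rw [ZMod.val_natCast, Nat.mod_eq_of_lt (by simpa using hk)]
    simp
  | succ n ih =>
    have hk' : (σ ((k / m ^ n : ℕ) : ZMod N)).val * m ^ n + k % m ^ n < N * m ^ n := by
      have h1 := ZMod.val_lt (σ ((k / m ^ n : ℕ) : ZMod N))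
      have h2 := Nat.mod_lt k (pow_pos hm n)
      have h3 := Nat.mul_le_mul_right (m ^ n) (Nat.succ_le_of_lt h1)
      rw [Nat.succ_mul] at h3
      omega
    obtain ⟨j, hj⟩ := ih hk'
    refine ⟨j, fun z hz => ?_⟩
    obtain ⟨y, hy, rfl⟩ := hj hz
    obtain ⟨x, hx, rfl⟩ := exists_mem_cylinder_succ m N hm σ hk hy
    exact ⟨x, hx, Function.iterate_succ_apply _ _ _⟩

theorem exists_iterate_eq_of_mem_transitionImage (m N : ℕ) [NeZero N] (hm : 0 < m)
    (σ : Equiv.Perm (ZMod N)) (A : Finset (ZMod N)) {r : ℕ} {i : ZMod N}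
    (hi : i ∈ (transitionImage m N σ)^[r] A) {y : Set.Ico (0 : ℝ) 1}
    (hy : y ∈ cylinder m N 0 i.val) :
    ∃ j ∈ A, ∃ x ∈ cylinder m N 0 j.val, (fun x => permMap N σ (mulMap m x))^[r] x = y := by
  induction r generalizing i y with
  | zero => exact ⟨i, hi, y, hy, rfl⟩
  | succ r ih =>
    rw [Function.iterate_succ_apply'] at hi
    obtain ⟨⟨a, d⟩, hp, rfl⟩ := Finset.mem_image.1 hi
    obtain ⟨ha, hd⟩ := Finset.mem_product.1 hp
    simp only [Finset.mem_range] at ha hd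
    have hlt : m * a.val + d < N * m ^ (0 + 1) := by
      have h := Nat.mul_le_mul_right m (Nat.succ_le_of_lt (ZMod.val_lt a))
      rw [Nat.succ_mul, mul_comm a.val] at h
      rw [zero_add, pow_one]
      omega
    obtain ⟨z, hz, rfl⟩ := exists_mem_cylinder_succ m N hm σ (n := 0) (k := m * a.val + d)
      hlt (y := y) (by simpa [Nat.mod_one] using hy)
    have hza : z ∈ cylinder m N 0 a.val := by
      obtain ⟨h0, h1⟩ := hz
      have hm' : (0 : ℝ) < m := Nat.cast_pos.2 hm
      have hd' : (d : ℝ) + 1 ≤ m := by exact_mod_cast hd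
      push_cast at h0 h1
      have hd0 : (0 : ℝ) ≤ d := Nat.cast_nonneg d
      constructor
      · refine le_of_mul_le_mul_left ?_ hm'
        rw [pow_one] at h0
        rw [pow_zero]
        linarith
      · refine lt_of_mul_lt_mul_left ?_ hm'.le
        rw [pow_one] at h1
        rw [pow_zero]
        linarith
    obtain ⟨j, hj, x, hx, hxz⟩ := ih ha hza
    exact ⟨j, hj, x, hx, by rw [Function.iterate_succ_apply', hxz]⟩

theorem mem_cylinder_floor (m N n : ℕ) (x : Set.Ico (0 : ℝ) 1) :
    x ∈ cylinder m N n ⌊(N : ℝ) * m ^ n * x.val⌋₊ :=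
  ⟨Nat.floor_le (mul_nonneg (by positivity) x.2.1), Nat.lt_floor_add_one _⟩

theorem floor_lt_mul_pow (m N n : ℕ) [NeZero N] (hm : 0 < m) (x : Set.Ico (0 : ℝ) 1) :
    ⌊(N : ℝ) * m ^ n * x.val⌋₊ < N * m ^ n := by
  have hP : (0 : ℝ) < N * m ^ n := by
    have := Nat.pos_of_ne_zero (NeZero.ne N)
    positivity
  rw [Nat.floor_lt (mul_nonneg hP.le x.2.1)]
  push_cast
  nlinarith [x.2.2]

theorem exists_cylinder_subset (m N : ℕ) [NeZero N] (hm : 2 ≤ m) {U : Set (Set.Ico (0 : ℝ) 1)}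
    (hU : IsOpen U) (hne : U.Nonempty) :
    ∃ n k : ℕ, k < N * m ^ n ∧ cylinder m N n k ⊆ U := by
  obtain ⟨x, hx⟩ := hne
  obtain ⟨ε, hε, hball⟩ := Metric.isOpen_iff.1 hU x hx
  have hm1 : (1 : ℝ) < m := by exact_mod_cast hm
  obtain ⟨n, hn⟩ := pow_unbounded_of_one_lt (1 / ε) hm1
  refine ⟨n, _, floor_lt_mul_pow m N n (by omega) x, fun y hy => hball ?_⟩
  have hx' := mem_cylinder_floor m N n x
  have hN : (1 : ℝ) ≤ N := by exact_mod_cast Nat.pos_of_ne_zero (NeZero.ne N)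
  have hMn : (0 : ℝ) < m ^ n := by positivity
  have hε' : 1 < N * m ^ n * ε := by
    rw [div_lt_iff₀ hε] at hn
    nlinarith [mul_pos hMn hε]
  have hP : (0 : ℝ) < N * m ^ n := by positivity
  rw [Metric.mem_ball, Subtype.dist_eq, Real.dist_eq, abs_lt]
  constructor
  · refine lt_of_mul_lt_mul_left ?_ hP.le
    linarith [hy.1, hx'.2]
  · refine lt_of_mul_lt_mul_left ?_ hP.le
    linarith [hy.2, hx'.1]

/-- if `N` is not a multiple of `m`, then `σ ∘ f` is topologically
mixing for every permutation `σ` of `ℤ/Nℤ`. -/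
theorem stmt0 (m N : ℕ) (hm : 2 ≤ m) (hN : 2 ≤ N) (hnd : ¬ (m ∣ N))
    (σ : Equiv.Perm (ZMod N)) :
    TopMixing (fun x => permMap N σ (mulMap m x)) := by
  have : NeZero N := ⟨by omega⟩
  have hm0 : 0 < m := by omega
  intro U V hU _ hUne hVne
  obtain ⟨v, hv⟩ := hVne
  obtain ⟨n, k, hk, hsub⟩ := exists_cylinder_subset m N hm hU hUne
  obtain ⟨j, hj⟩ := exists_cylinder_zero_subset_image m N hm0 σ hk
  refine ⟨N + n, fun l hl => ⟨v, ?_, hv⟩⟩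
  obtain ⟨r, rfl⟩ := Nat.exists_eq_add_of_le' (show n ≤ l by omega)
  have hlt := floor_lt_mul_pow m N 0 hm0 v
  rw [pow_zero, mul_one, pow_zero, mul_one] at hlt
  have hvc := mem_cylinder_floor m N 0 v
  rw [pow_zero, mul_one, ← ZMod.val_natCast_of_lt hlt] at hvc
  obtain ⟨j', hj', y, hy, hyv⟩ := exists_iterate_eq_of_mem_transitionImage m N hm0 σ {j} (r := r)
    (by rw [iterate_transitionImage_eq_univ m N hm0 hnd σ (Finset.singleton_nonempty j)
          (by omega)]
        exact Finset.mem_univ _) hvc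
  rw [Finset.mem_singleton] at hj'
  subst hj'
  obtain ⟨x, hx, rfl⟩ := hj hy
  exact ⟨x, hsub hx, by rw [Function.iterate_add_apply, hyv]⟩
end

section
/- Let m ≥ 2, ℓ ≥ 1 and N = mℓ. There exists a permutation δ of ℤ/Nℤ with f(I_j) ⊇ I_{δ(j)} for all j ∈ ℤ/Nℤ, and for any such δ the following holds: for every permutation σ of ℤ/Nℤ, the composite g = σ ∘ f fails to be topologically mixing if and only if there is some nontrivial ℓ-stable block decomposition 𝔅 of ℤ/Nℤ such that σ∘δ ∈ G_𝔅. -/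
open Set

/-- The index of the subinterval `I_j` containing a point. -/
noncomputable def cellIndex (N : ℕ) (x : Set.Ico (0:ℝ) 1) : ZMod N :=
  ((⌊(N : ℝ) * x.val⌋ : ℤ) : ZMod N)

section Cells

variable {N : ℕ} [NeZero N]

theorem cellIndex_val (x : Set.Ico (0:ℝ) 1) :
    ((cellIndex N x).val : ℤ) = ⌊(N : ℝ) * x.val⌋ := by
  have hN : (0:ℝ) < N := Nat.cast_pos.2 (NeZero.pos N)
  have h0 := x.2.1
  have h1 := x.2.2
  rw [cellIndex, ZMod.val_intCast]
  apply Int.emod_eq_of_lt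
  · exact Int.floor_nonneg.2 (by positivity)
  · rw [Int.floor_lt]
    push_cast
    nlinarith

theorem cellIndex_eq_iff (x : Set.Ico (0:ℝ) 1) (j : ZMod N) :
    cellIndex N x = j ↔ ⌊(N : ℝ) * x.val⌋ = (j.val : ℤ) := by
  rw [← cellIndex_val, Nat.cast_inj]
  exact (ZMod.val_injective N).eq_iff.symm

theorem mem_Isub_iff (x : Set.Ico (0:ℝ) 1) (j : ZMod N) :
    x ∈ Isub N j ↔ cellIndex N x = j := by
  have hN : (0:ℝ) < N := Nat.cast_pos.2 (NeZero.pos N)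
  rw [cellIndex_eq_iff, Int.floor_eq_iff, Isub, mem_ofPred_eq, div_le_iff₀' hN, lt_div_iff₀' hN]
  simp

theorem exists_cellIndex_eq (j : ZMod N) : ∃ x, cellIndex N x = j := by
  have hN : (0:ℝ) < N := Nat.cast_pos.2 (NeZero.pos N)
  have hj : (j.val : ℝ) < N := Nat.cast_lt.2 j.val_lt
  refine ⟨⟨(j.val : ℝ) / N, by positivity, (div_lt_one hN).2 hj⟩, ?_⟩
  rw [cellIndex_eq_iff]
  simp only
  rw [mul_div_cancel₀ _ hN.ne', Int.floor_natCast]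

/-- The cell `I_j` contains a nonempty open set. -/
theorem exists_isOpen_subset_cell (j : ZMod N) :
    ∃ U : Set (Set.Ico (0:ℝ) 1), IsOpen U ∧ U.Nonempty ∧ ∀ x ∈ U, cellIndex N x = j := by
  have hN : (0:ℝ) < N := Nat.cast_pos.2 (NeZero.pos N)
  have hj : (j.val : ℝ) + 1 ≤ N := by exact_mod_cast j.val_lt
  refine ⟨Subtype.val ⁻¹' Ioo ((j.val : ℝ) / N) (((j.val : ℝ) + 1) / N),
    isOpen_Ioo.preimage continuous_subtype_val,
    ⟨⟨((j.val : ℝ) + 1 / 2) / N, by positivity, (div_lt_one hN).2 (by linarith)⟩, ?_⟩, ?_⟩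
  · constructor <;> simp only <;> gcongr <;> linarith
  · intro x hx
    exact (mem_Isub_iff x j).1 ⟨hx.1.le, hx.2⟩

theorem permMap_val (σ : Equiv.Perm (ZMod N)) (x : Set.Ico (0:ℝ) 1) :
    (permMap N σ x).val =
      x.val + (((σ (cellIndex N x)).val : ℝ) - (cellIndex N x).val) / N := by
  have hN : (0:ℝ) < N := Nat.cast_pos.2 (NeZero.pos N)
  have hx := (mem_Isub_iff x (cellIndex N x)).2 rfl
  obtain ⟨h0, h1⟩ := hx
  have hj : ((σ (cellIndex N x)).val : ℝ) + 1 ≤ N := by exact_mod_cast (σ (cellIndex N x)).val_lt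
  rw [div_le_iff₀ hN] at h0
  rw [lt_div_iff₀ hN] at h1
  change Int.fract (x.val + (((σ (cellIndex N x)).val : ℝ) - (cellIndex N x).val) / N) = _
  rw [Int.fract_eq_self]
  have e : x.val + (((σ (cellIndex N x)).val : ℝ) - (cellIndex N x).val) / N
      = (x.val * N - (cellIndex N x).val + (σ (cellIndex N x)).val) / N := by
    field_simp
    ring
  rw [e, div_lt_one hN]
  refine ⟨div_nonneg ?_ hN.le, by linarith⟩
  have : (0:ℝ) ≤ (σ (cellIndex N x)).val := Nat.cast_nonneg _
  linarith

theorem cellIndex_permMap (σ : Equiv.Perm (ZMod N)) (x : Set.Ico (0:ℝ) 1) :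
    cellIndex N (permMap N σ x) = σ (cellIndex N x) := by
  have hN : (0:ℝ) < N := Nat.cast_pos.2 (NeZero.pos N)
  have e : (N : ℝ) * (permMap N σ x).val = N * x.val +
      (((σ (cellIndex N x)).val - (cellIndex N x).val : ℤ) : ℝ) := by
    rw [permMap_val]
    push_cast
    field_simp
  rw [cellIndex_eq_iff, e, Int.floor_add_intCast, ← cellIndex_val]
  ring

theorem permMap_permMap_inv (σ : Equiv.Perm (ZMod N)) (x : Set.Ico (0:ℝ) 1) :
    permMap N σ (permMap N σ⁻¹ x) = x := by
  apply Subtype.ext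
  rw [permMap_val, cellIndex_permMap, permMap_val]
  simp only [Equiv.Perm.coe_inv, Equiv.apply_symm_apply]
  ring

/-- `permMap` carries grid cells of any mesh `1 / (N * K)` onto such cells. -/
theorem exists_permMap_eq_of_floor_eq (σ : Equiv.Perm (ZMod N)) {K : ℕ} (hK : 0 < K)
    {y z : Set.Ico (0:ℝ) 1}
    (h : ⌊(N * K : ℝ) * y.val⌋ = ⌊(N * K : ℝ) * (permMap N σ z).val⌋) :
    ∃ x, ⌊(N * K : ℝ) * x.val⌋ = ⌊(N * K : ℝ) * z.val⌋ ∧ permMap N σ x = y := by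
  have hN : (0:ℝ) < N := Nat.cast_pos.2 (NeZero.pos N)
  have hK' : (0:ℝ) < K := Nat.cast_pos.2 hK
  have key : ∀ w : ℝ, ⌊(N : ℝ) * w⌋ = ⌊(N * K : ℝ) * w⌋ / (K : ℤ) := by
    intro w
    rw [← Int.floor_div_natCast]
    congr 1
    field_simp
  have hc : cellIndex N y = σ (cellIndex N z) := by
    rw [← cellIndex_permMap, cellIndex_eq_iff, cellIndex_val, key, key, h]
  refine ⟨permMap N σ⁻¹ y, ?_, permMap_permMap_inv σ y⟩
  have e1 : (N * K : ℝ) * (permMap N σ⁻¹ y).val = (N * K : ℝ) * y.val +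
      (((K : ℤ) * ((cellIndex N z).val - (σ (cellIndex N z)).val) : ℤ) : ℝ) := by
    rw [permMap_val, hc, Equiv.Perm.coe_inv, Equiv.symm_apply_apply]
    push_cast
    field_simp
  have e2 : (N * K : ℝ) * (permMap N σ z).val = (N * K : ℝ) * z.val -
      (((K : ℤ) * ((cellIndex N z).val - (σ (cellIndex N z)).val) : ℤ) : ℝ) := by
    rw [permMap_val]
    push_cast
    field_simp
    ring
  rw [e2, Int.floor_sub_intCast] at h
  rw [e1, Int.floor_add_intCast, h]
  ring

end Cells

/-- `mulMap m` carries grid cells of mesh `1 / (m * M)` onto cells of mesh `1 / M`. -/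
theorem exists_mulMap_eq_of_floor_eq {m : ℕ} (hm : 0 < m) (M : ℕ) {y z : Set.Ico (0:ℝ) 1}
    (h : ⌊(M : ℝ) * y.val⌋ = ⌊(M : ℝ) * (mulMap m z).val⌋) :
    ∃ x, ⌊(m * M : ℝ) * x.val⌋ = ⌊(m * M : ℝ) * z.val⌋ ∧ mulMap m x = y := by
  have hm' : (0:ℝ) < m := Nat.cast_pos.2 hm
  have hz0 := z.2.1
  have hz1 := z.2.2
  have hy0 := y.2.1
  have hy1 := y.2.2
  have hq0 : 0 ≤ ⌊(m : ℝ) * z.val⌋ := Int.floor_nonneg.2 (by positivity)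
  have hq1 : ⌊(m : ℝ) * z.val⌋ + 1 ≤ (m : ℤ) := by
    rw [Int.add_one_le_iff, Int.floor_lt]
    push_cast
    nlinarith
  have hf : (mulMap m z).val = m * z.val - ⌊(m : ℝ) * z.val⌋ := rfl
  generalize ⌊(m : ℝ) * z.val⌋ = q at *
  have hq0' : (0:ℝ) ≤ q := by exact_mod_cast hq0
  have hq1' : (q : ℝ) + 1 ≤ m := by exact_mod_cast hq1
  refine ⟨⟨(y.val + q) / m, by positivity, (div_lt_one hm').2 (by linarith)⟩, ?_, ?_⟩
  · have e1 : (m * M : ℝ) * ((y.val + q) / m) = M * y.val + ((M * q : ℤ) : ℝ) := by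
      push_cast
      field_simp
    have e2 : (m * M : ℝ) * z.val = M * (mulMap m z).val + ((M * q : ℤ) : ℝ) := by
      rw [hf]
      push_cast
      ring
    simp only
    rw [e1, e2, Int.floor_add_intCast, Int.floor_add_intCast, h]
  · apply Subtype.ext
    change Int.fract ((m : ℝ) * ((y.val + q) / m)) = y.val
    rw [mul_div_cancel₀ _ hm'.ne', Int.fract_add_intCast, Int.fract_eq_self]
    exact ⟨hy0, hy1⟩

section Markov

variable {m ℓ N : ℕ} [NeZero N]

theorem cellIndex_val_div (hm : 0 < m) (hN : N = m * ℓ) (x : Set.Ico (0:ℝ) 1) :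
    (((cellIndex N x).val / m : ℕ) : ℤ) = ⌊(ℓ : ℝ) * x.val⌋ := by
  have hm' : (0:ℝ) < m := Nat.cast_pos.2 hm
  rw [Int.natCast_div, cellIndex_val, ← Int.floor_div_natCast]
  congr 1
  rw [hN]
  push_cast
  field_simp

theorem cellIndex_mulMap (hm : 0 < m) (hl : 0 < ℓ) (hN : N = m * ℓ) (x : Set.Ico (0:ℝ) 1) :
    (cellIndex N (mulMap m x)).val / m = (cellIndex N x).val % ℓ := by
  zify
  have h := cellIndex_val_div hm hN (mulMap m x)
  push_cast at h
  rw [h, cellIndex_val]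
  have hf : (mulMap m x).val = m * x.val - ⌊(m : ℝ) * x.val⌋ := rfl
  have hl' : (0:ℝ) < ℓ := Nat.cast_pos.2 hl
  have e1 : (ℓ : ℝ) * (mulMap m x).val = N * x.val - ((ℓ * ⌊(m : ℝ) * x.val⌋ : ℤ) : ℝ) := by
    rw [hf, hN]
    push_cast
    ring
  have e2 : ⌊(m : ℝ) * x.val⌋ = ⌊(N : ℝ) * x.val⌋ / (ℓ : ℤ) := by
    rw [← Int.floor_div_natCast, hN]
    congr 1
    push_cast
    field_simp
  rw [e1, Int.floor_sub_intCast, e2, Int.emod_def]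

theorem exists_mulMap_eq_of_cellIndex (hm : 0 < m) (hl : 0 < ℓ) (hN : N = m * ℓ)
    {y : Set.Ico (0:ℝ) 1} {j : ZMod N} (h : (cellIndex N y).val / m = j.val % ℓ) :
    ∃ x, cellIndex N x = j ∧ mulMap m x = y := by
  obtain ⟨z, rfl⟩ := exists_cellIndex_eq j
  rw [← cellIndex_mulMap hm hl hN, ← Nat.cast_inj (R := ℤ), cellIndex_val_div hm hN,
    cellIndex_val_div hm hN] at h
  obtain ⟨x, hx, hxy⟩ := exists_mulMap_eq_of_floor_eq hm ℓ h
  refine ⟨x, ?_, hxy⟩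
  rw [cellIndex_eq_iff, cellIndex_val, hN]
  push_cast
  exact hx

theorem Isub_subset_image_mulMap_iff (hm : 0 < m) (hl : 0 < ℓ) (hN : N = m * ℓ) (i j : ZMod N) :
    Isub N i ⊆ (fun x => mulMap m x) '' Isub N j ↔ i.val / m = j.val % ℓ := by
  constructor
  · intro h
    obtain ⟨y, rfl⟩ := exists_cellIndex_eq i
    obtain ⟨x, hx, rfl⟩ := h ((mem_Isub_iff y _).2 rfl)
    rw [mem_Isub_iff] at hx
    rw [cellIndex_mulMap hm hl hN, hx]
  · intro h y hy
    rw [mem_Isub_iff] at hy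
    obtain ⟨x, hx, hxy⟩ := exists_mulMap_eq_of_cellIndex hm hl hN (y := y) (j := j) (by rw [hy, h])
    exact ⟨x, (mem_Isub_iff x j).2 hx, hxy⟩

theorem exists_perm_val_div_eq (hm : 0 < m) (hl : 0 < ℓ) (hN : N = m * ℓ) :
    ∃ δ : Equiv.Perm (ZMod N), ∀ j, (δ j).val / m = j.val % ℓ := by
  have hq : ∀ j : ZMod N, j.val / ℓ < m := fun j =>
    Nat.div_lt_of_lt_mul (by rw [mul_comm, ← hN]; exact j.val_lt)
  have hv : ∀ j : ZMod N, ((m * (j.val % ℓ) + j.val / ℓ : ℕ) : ZMod N).val =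
      m * (j.val % ℓ) + j.val / ℓ := by
    intro j
    apply ZMod.val_cast_of_lt
    have h1 := Nat.mod_lt j.val hl
    have h2 := hq j
    calc m * (j.val % ℓ) + j.val / ℓ < m * (j.val % ℓ) + m := by omega
      _ = m * (j.val % ℓ + 1) := by ring
      _ ≤ m * ℓ := Nat.mul_le_mul_left m h1
      _ = N := hN.symm
  have hd : ∀ j : ZMod N, (m * (j.val % ℓ) + j.val / ℓ) / m = j.val % ℓ := fun j => by
    rw [Nat.mul_add_div hm, Nat.div_eq_of_lt (hq j), add_zero]
  have hr : ∀ j : ZMod N, (m * (j.val % ℓ) + j.val / ℓ) % m = j.val / ℓ := fun j => by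
    rw [Nat.mul_add_mod, Nat.mod_eq_of_lt (hq j)]
  have hinj : Function.Injective
      (fun j : ZMod N => ((m * (j.val % ℓ) + j.val / ℓ : ℕ) : ZMod N)) := by
    intro i j hij
    have h := congrArg ZMod.val hij
    simp only [hv] at h
    apply ZMod.val_injective N
    have h1 := hd i
    have h2 := hr i
    rw [h, hd j] at h1
    rw [h, hr j] at h2
    rw [← Nat.div_add_mod i.val ℓ, ← Nat.div_add_mod j.val ℓ, h1, h2]
  refine ⟨Equiv.ofBijective _ (Finite.injective_iff_bijective.1 hinj), fun j => ?_⟩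
  rw [Equiv.ofBijective_apply, hv, hd]

/-- The set of indices reachable in one step from `A` in the Markov graph of `σ ∘ f`,
where `τ = σ ∘ δ`: it is the image under `τ` of the `ℓ`-saturation of `A`. -/
def markovStep (ℓ : ℕ) (τ : Equiv.Perm (ZMod N)) (A : Set (ZMod N)) : Set (ZMod N) :=
  {k | ∃ i ∈ A, (τ⁻¹ k).val % ℓ = i.val % ℓ}

theorem image_preimage_cellIndex (hm : 0 < m) (hl : 0 < ℓ) (hN : N = m * ℓ)
    {δ : Equiv.Perm (ZMod N)} (hδ : ∀ j, (δ j).val / m = j.val % ℓ) (σ : Equiv.Perm (ZMod N))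
    (A : Set (ZMod N)) :
    (fun x => permMap N σ (mulMap m x)) '' (cellIndex N ⁻¹' A) =
      cellIndex N ⁻¹' markovStep ℓ (σ * δ) A := by
  have hE : ∀ k, ((σ * δ)⁻¹ k).val % ℓ = (σ⁻¹ k).val / m := fun k => by
    rw [← hδ, mul_inv_rev, Equiv.Perm.mul_apply, Equiv.Perm.coe_inv, Equiv.apply_symm_apply]
  ext y
  simp only [mem_image, mem_preimage, markovStep, mem_ofPred_eq, hE]
  constructor
  · rintro ⟨x, hx, rfl⟩
    refine ⟨_, hx, ?_⟩
    rw [cellIndex_permMap, Equiv.Perm.coe_inv, Equiv.symm_apply_apply, cellIndex_mulMap hm hl hN]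
  · rintro ⟨i, hi, h⟩
    rw [← cellIndex_permMap] at h
    obtain ⟨x, rfl, hxy⟩ := exists_mulMap_eq_of_cellIndex hm hl hN h
    exact ⟨x, hi, by rw [hxy, permMap_permMap_inv]⟩

theorem iterate_image_preimage_cellIndex (hm : 0 < m) (hl : 0 < ℓ) (hN : N = m * ℓ)
    {δ : Equiv.Perm (ZMod N)} (hδ : ∀ j, (δ j).val / m = j.val % ℓ) (σ : Equiv.Perm (ZMod N))
    (A : Set (ZMod N)) (n : ℕ) :
    (fun x => permMap N σ (mulMap m x))^[n] '' (cellIndex N ⁻¹' A) =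
      cellIndex N ⁻¹' (markovStep ℓ (σ * δ))^[n] A := by
  induction n with
  | zero => simp
  | succ n ih =>
    rw [Function.iterate_succ', Function.iterate_succ_apply', image_comp, ih,
      image_preimage_cellIndex hm hl hN hδ]

/-- Some iterate of `σ ∘ f` maps a small grid cell over a whole interval `I_j`. -/
theorem exists_preimage_cellIndex_subset_iterate_image (hm : 0 < m) (σ : Equiv.Perm (ZMod N))
    (n : ℕ) (z : Set.Ico (0:ℝ) 1) :
    ∃ j : ZMod N, cellIndex N ⁻¹' {j} ⊆ (fun x => permMap N σ (mulMap m x))^[n] ''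
      {x | ⌊(N * (m ^ n : ℕ) : ℝ) * x.val⌋ = ⌊(N * (m ^ n : ℕ) : ℝ) * z.val⌋} := by
  induction n generalizing z with
  | zero =>
    refine ⟨cellIndex N z, fun x hx => ⟨x, ?_, rfl⟩⟩
    rw [mem_preimage, mem_singleton_iff, cellIndex_eq_iff, cellIndex_val] at hx
    simpa using hx
  | succ n ih =>
    obtain ⟨j, hj⟩ := ih (permMap N σ (mulMap m z))
    refine ⟨j, hj.trans ?_⟩
    rw [Function.iterate_succ, image_comp]
    apply image_mono
    intro y hy
    obtain ⟨w, hw, rfl⟩ := exists_permMap_eq_of_floor_eq σ (pow_pos hm n) hy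
    rw [← Nat.cast_mul] at hw
    obtain ⟨x, hx, rfl⟩ := exists_mulMap_eq_of_floor_eq hm _ hw
    refine ⟨x, ?_, rfl⟩
    have e : (N * (m ^ (n + 1) : ℕ) : ℝ) = m * (N * m ^ n : ℕ) := by
      push_cast
      ring
    rw [mem_ofPred_eq, e, hx]

theorem exists_iterate_image_superset_cell (hm : 2 ≤ m) (σ : Equiv.Perm (ZMod N))
    {U : Set (Set.Ico (0:ℝ) 1)} (hU : IsOpen U) (hne : U.Nonempty) :
    ∃ (n : ℕ) (j : ZMod N),
      cellIndex N ⁻¹' {j} ⊆ (fun x => permMap N σ (mulMap m x))^[n] '' U := by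
  obtain ⟨z, hz⟩ := hne
  obtain ⟨ε, hε, hball⟩ := Metric.isOpen_iff.1 hU z hz
  have hN : (1:ℝ) ≤ N := Nat.one_le_cast.2 (NeZero.pos N)
  have hm' : (1:ℝ) < m := by exact_mod_cast hm
  obtain ⟨n, hn⟩ := pow_unbounded_of_one_lt ε⁻¹ hm'
  obtain ⟨j, hj⟩ := exists_preimage_cellIndex_subset_iterate_image (by omega : 0 < m) σ n z
  refine ⟨n, j, hj.trans (image_mono fun x hx => hball ?_)⟩
  have h := Int.abs_sub_lt_one_of_floor_eq_floor hx
  have hp : (0:ℝ) < m ^ n := by positivity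
  rw [← mul_sub, abs_mul, abs_of_pos (by push_cast; positivity)] at h
  rw [Metric.mem_ball, Subtype.dist_eq, Real.dist_eq]
  push_cast at h
  have h1 : 1 < ε * m ^ n := by
    rwa [inv_lt_iff_one_lt_mul₀ hε, mul_comm] at hn
  have h2 : (m:ℝ) ^ n * |x.val - z.val| < m ^ n * ε := by
    have h3 : (m:ℝ) ^ n * |x.val - z.val| ≤ N * m ^ n * |x.val - z.val| := by
      rw [mul_assoc]
      exact le_mul_of_one_le_left (by positivity) hN
    linarith
  exact lt_of_mul_lt_mul_left h2 hp.le

end Markov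

section Blocks

variable {ℓ N : ℕ}

theorem image_subset_markovStep (τ : Equiv.Perm (ZMod N)) (A : Set (ZMod N)) :
    τ '' A ⊆ markovStep ℓ τ A := by
  rintro _ ⟨i, hi, rfl⟩
  exact ⟨i, hi, by simp⟩

/-- `A` and all its translates under powers of `τ` are `ℓ`-stable. -/
def FullyStable (ℓ : ℕ) (τ : Equiv.Perm (ZMod N)) (A : Set (ZMod N)) : Prop :=
  ∀ (k : ℤ) (x : ZMod N), (τ ^ k) x ∈ A ↔ (τ ^ k) (x + (ℓ : ZMod N)) ∈ A

theorem FullyStable.preimage_zpow {τ : Equiv.Perm (ZMod N)} {A : Set (ZMod N)}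
    (hA : FullyStable ℓ τ A) (j : ℤ) : FullyStable ℓ τ ((τ ^ j : Equiv.Perm (ZMod N)) ⁻¹' A) := by
  intro k x
  simp only [mem_preimage, ← Equiv.Perm.mul_apply, ← zpow_add]
  exact hA (j + k) x

/-- Indices that are not separated by any fully stable set. -/
def stableSetoid (ℓ : ℕ) (τ : Equiv.Perm (ZMod N)) : Setoid (ZMod N) where
  r i j := ∀ A, FullyStable ℓ τ A → (i ∈ A ↔ j ∈ A)
  iseqv := ⟨fun _ _ _ => Iff.rfl, fun h A hA => (h A hA).symm,
    fun h₁ h₂ A hA => (h₁ A hA).trans (h₂ A hA)⟩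

theorem stableSetoid_zpow {τ : Equiv.Perm (ZMod N)} (k : ℤ) {i j : ZMod N}
    (h : stableSetoid ℓ τ i j) : stableSetoid ℓ τ ((τ ^ k) i) ((τ ^ k) j) :=
  fun _ hA => h _ (hA.preimage_zpow k)

theorem stableSetoid_add (τ : Equiv.Perm (ZMod N)) (i : ZMod N) :
    stableSetoid ℓ τ (i + (ℓ : ZMod N)) i :=
  fun _ hA => (hA 0 i).symm

theorem image_class_stableSetoid (τ : Equiv.Perm (ZMod N)) (i : ZMod N) :
    τ '' {x | stableSetoid ℓ τ x i} = {x | stableSetoid ℓ τ x (τ i)} := by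
  ext y
  constructor
  · rintro ⟨x, hx, rfl⟩
    exact stableSetoid_zpow 1 hx
  · intro hy
    refine ⟨τ⁻¹ y, ?_, by simp⟩
    have := stableSetoid_zpow (-1) hy
    simpa using this

theorem image_classes_stableSetoid (τ : Equiv.Perm (ZMod N)) :
    Set.image τ '' (stableSetoid ℓ τ).classes = (stableSetoid ℓ τ).classes := by
  ext B
  constructor
  · rintro ⟨_, ⟨i, rfl⟩, rfl⟩
    exact ⟨τ i, image_class_stableSetoid τ i⟩
  · rintro ⟨i, rfl⟩
    refine ⟨_, ⟨τ⁻¹ i, rfl⟩, ?_⟩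
    rw [image_class_stableSetoid]
    simp

theorem markovStep_univ (τ : Equiv.Perm (ZMod N)) : markovStep ℓ τ univ = univ :=
  eq_univ_of_forall fun k => ⟨τ⁻¹ k, mem_univ _, rfl⟩

theorem markovStep_nonempty (τ : Equiv.Perm (ZMod N)) {A : Set (ZMod N)} (hA : A.Nonempty) :
    (markovStep ℓ τ A).Nonempty :=
  (hA.image τ).mono (image_subset_markovStep τ A)

theorem iterate_markovStep_nonempty (τ : Equiv.Perm (ZMod N)) {A : Set (ZMod N)}
    (hA : A.Nonempty) (n : ℕ) : ((markovStep ℓ τ)^[n] A).Nonempty := by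
  induction n with
  | zero => exact hA
  | succ n ih =>
    rw [Function.iterate_succ_apply']
    exact markovStep_nonempty τ ih

theorem univ_notMem_of_isPartition {α : Type*} {𝔅 : Set (Set α)} (hp : Setoid.IsPartition 𝔅)
    (hne : 𝔅 ≠ {univ}) : univ ∉ 𝔅 := by
  intro hu
  refine hne (eq_singleton_iff_unique_mem.2 ⟨hu, fun B hB => ?_⟩)
  obtain ⟨b, hb⟩ : B.Nonempty := nonempty_iff_ne_empty.2 fun h => hp.1 (h ▸ hB)
  exact (hp.2 b).unique ⟨hB, hb⟩ ⟨hu, mem_univ b⟩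

variable [NeZero N]

theorem val_add_mod_of_dvd (h : ℓ ∣ N) (a : ZMod N) : (a + (ℓ : ZMod N)).val % ℓ = a.val % ℓ := by
  rw [ZMod.val_add, ZMod.val_natCast, Nat.mod_mod_of_dvd _ h, Nat.add_mod,
    Nat.mod_mod_of_dvd _ h]
  simp

theorem mem_of_val_mod_eq (h : ℓ ∣ N) {A : Set (ZMod N)} (hA : ∀ j ∈ A, j + (ℓ : ZMod N) ∈ A)
    {a b : ZMod N} (ha : a ∈ A) (hab : b.val % ℓ = a.val % ℓ) : b ∈ A := by
  have hn : ∀ n : ℕ, a + ((n * ℓ : ℕ) : ZMod N) ∈ A := by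
    intro n
    induction n with
    | zero => simpa using ha
    | succ n ih =>
      have := hA _ ih
      convert this using 1
      push_cast
      ring
  have hlt := a.val_lt
  have hd : ℓ ∣ b.val + N - a.val := by
    rw [← Nat.modEq_iff_dvd' (by omega)]
    exact Nat.ModEq.trans hab.symm ((Nat.modEq_zero_iff_dvd.2 h).symm.add_left b.val)
  obtain ⟨q, hq⟩ := hd
  have := hn q
  rw [mul_comm, ← hq, Nat.cast_sub (by omega)] at this
  simpa using this

theorem markovStep_eq_image_of_stable (h : ℓ ∣ N) (τ : Equiv.Perm (ZMod N)) {A : Set (ZMod N)}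
    (hA : ∀ j ∈ A, j + (ℓ : ZMod N) ∈ A) : markovStep ℓ τ A = τ '' A := by
  ext k
  constructor
  · rintro ⟨i, hi, hik⟩
    exact ⟨τ⁻¹ k, mem_of_val_mod_eq h hA hi hik, by simp⟩
  · rintro ⟨i, hi, rfl⟩
    exact ⟨i, hi, by simp⟩

theorem mem_iff_add_mem_of_markovStep_eq_image (h : ℓ ∣ N) {τ : Equiv.Perm (ZMod N)}
    {A : Set (ZMod N)} (hA : markovStep ℓ τ A = τ '' A) (x : ZMod N) :
    x ∈ A ↔ x + (ℓ : ZMod N) ∈ A := by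
  constructor
  · intro hx
    rw [← τ.injective.mem_set_image, ← hA]
    exact ⟨x, hx, by simp [val_add_mod_of_dvd h]⟩
  · intro hx
    rw [← τ.injective.mem_set_image, ← hA]
    exact ⟨_, hx, by simp [val_add_mod_of_dvd h]⟩

theorem fullyStable_of_iterate (h : ℓ ∣ N) {τ : Equiv.Perm (ZMod N)} {A : Set (ZMod N)}
    (hA : ∀ n, markovStep ℓ τ ((markovStep ℓ τ)^[n] A) = τ '' (markovStep ℓ τ)^[n] A) :
    FullyStable ℓ τ A := by
  have hit : ∀ n : ℕ, (markovStep ℓ τ)^[n] A = (τ ^ n : Equiv.Perm (ZMod N)) '' A := by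
    intro n
    induction n with
    | zero => simp
    | succ n ih =>
      rw [Function.iterate_succ_apply', hA, ih, ← image_comp, pow_succ', Equiv.Perm.coe_mul]
  have hs : ∀ (n : ℕ) (x : ZMod N), (τ ^ n : Equiv.Perm (ZMod N))⁻¹ x ∈ A ↔
      (τ ^ n : Equiv.Perm (ZMod N))⁻¹ (x + (ℓ : ZMod N)) ∈ A := by
    intro n x
    have := mem_iff_add_mem_of_markovStep_eq_image h (hA n) x
    rw [hit, Equiv.image_eq_preimage_symm] at this
    exact this
  intro k x
  have hk : (τ ^ k)⁻¹ ∈ Submonoid.powers τ := by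
    rw [(isOfFinOrder_of_finite τ).mem_powers_iff_mem_zpowers]
    exact inv_mem ⟨k, rfl⟩
  obtain ⟨n, hn⟩ := hk
  have := hs n x
  rwa [show τ ^ n = (τ ^ k)⁻¹ from hn, inv_inv] at this

/-- The orbit of a singleton under `markovStep` eventually reaches a fully stable set. -/
theorem exists_fullyStable_iterate (h : ℓ ∣ N) (τ : Equiv.Perm (ZMod N)) (j : ZMod N) :
    ∃ n, FullyStable ℓ τ ((markovStep ℓ τ)^[n] {j}) := by
  have hmono : Monotone fun n => ((markovStep ℓ τ)^[n] {j}).ncard := by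
    refine monotone_nat_of_le_succ fun n => ?_
    rw [Function.iterate_succ_apply', ← ncard_image_of_injective _ τ.injective]
    exact ncard_le_ncard (image_subset_markovStep τ _) (toFinite _)
  have hbdd : BddAbove (range fun n => ((markovStep ℓ τ)^[n] {j}).ncard) := by
    refine ⟨Nat.card (ZMod N), ?_⟩
    rintro _ ⟨n, rfl⟩
    exact ncard_le_card _
  obtain ⟨n, hn⟩ := Nat.sSup_mem (range_nonempty _) hbdd
  refine ⟨n, fullyStable_of_iterate h fun k => ?_⟩
  symm
  apply eq_of_subset_of_ncard_le (image_subset_markovStep τ _) _ (toFinite _)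
  rw [ncard_image_of_injective _ τ.injective, ← Function.iterate_succ_apply' (markovStep ℓ τ),
    ← Function.iterate_add_apply, ← Function.iterate_add_apply]
  exact (le_csSup hbdd ⟨_, rfl⟩).trans (hn.symm.le.trans (hmono (Nat.le_add_left n k)))

/-- If the only `τ`-invariant `ℓ`-stable block decomposition is the trivial one, then every index
eventually reaches all indices. -/
theorem exists_iterate_markovStep_eq_univ (h : ℓ ∣ N) (τ : Equiv.Perm (ZMod N))
    (htriv : ∀ 𝔅 : Set (Set (ZMod N)), Setoid.IsPartition 𝔅 →
      (∀ A ∈ 𝔅, ∀ j ∈ A, j + (ℓ : ZMod N) ∈ A) → Set.image τ '' 𝔅 = 𝔅 → 𝔅 = {Set.univ})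
    (j : ZMod N) : ∃ n, (markovStep ℓ τ)^[n] {j} = univ := by
  have hcl := htriv _ (Setoid.isPartition_classes (stableSetoid ℓ τ))
    (by
      rintro _ ⟨i, rfl⟩ x hx
      exact (stableSetoid ℓ τ).trans (stableSetoid_add τ x) hx)
    (image_classes_stableSetoid τ)
  obtain ⟨n, hn⟩ := exists_fullyStable_iterate h τ j
  obtain ⟨i, hi⟩ := iterate_markovStep_nonempty (ℓ := ℓ) τ (singleton_nonempty j) n
  refine ⟨n, eq_univ_of_forall fun k => ?_⟩
  have hk : {x | stableSetoid ℓ τ x i} = univ := by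
    have : {x | stableSetoid ℓ τ x i} ∈ (stableSetoid ℓ τ).classes := ⟨i, rfl⟩
    rwa [hcl, mem_singleton_iff] at this
  have hki : stableSetoid ℓ τ k i := by
    have := mem_univ k
    rwa [← hk] at this
  exact (hki _ hn).2 hi

/-- Iterating `markovStep` on a block of an invariant decomposition stays in the decomposition. -/
theorem iterate_markovStep_mem (h : ℓ ∣ N) {τ : Equiv.Perm (ZMod N)} {𝔅 : Set (Set (ZMod N))}
    (hst : ∀ A ∈ 𝔅, ∀ j ∈ A, j + (ℓ : ZMod N) ∈ A) (hinv : Set.image τ '' 𝔅 = 𝔅)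
    {A : Set (ZMod N)} (hA : A ∈ 𝔅) (n : ℕ) : (markovStep ℓ τ)^[n] A ∈ 𝔅 := by
  induction n with
  | zero => exact hA
  | succ n ih =>
    rw [Function.iterate_succ_apply', markovStep_eq_image_of_stable h τ (hst _ ih)]
    exact hinv ▸ mem_image_of_mem _ ih

end Blocks

/-- characterisation of non-mixing permutations when `N = mℓ`,
via `ℓ`-stable block decompositions. -/
theorem stmt1 (m ℓ N : ℕ) (hm : 2 ≤ m) (hl : 1 ≤ ℓ) (hN : N = m * ℓ) :
    (∃ δ : Equiv.Perm (ZMod N),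
        ∀ j : ZMod N, Isub N (δ j) ⊆ (fun x => mulMap m x) '' Isub N j) ∧
    (∀ δ : Equiv.Perm (ZMod N),
      (∀ j : ZMod N, Isub N (δ j) ⊆ (fun x => mulMap m x) '' Isub N j) →
      ∀ σ : Equiv.Perm (ZMod N),
        (¬ TopMixing (fun x => permMap N σ (mulMap m x))) ↔
          ∃ 𝔅 : Set (Set (ZMod N)), Setoid.IsPartition 𝔅 ∧ 𝔅 ≠ {Set.univ} ∧
            (∀ A ∈ 𝔅, ∀ j ∈ A, j + (ℓ : ZMod N) ∈ A) ∧
            (Set.image (⇑(σ * δ)) '' 𝔅 = 𝔅)) := by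
  have hm0 : 0 < m := by omega
  have hdvd : ℓ ∣ N := hN ▸ dvd_mul_left ℓ m
  have : NeZero N := ⟨by rw [hN]; positivity⟩
  simp only [Isub_subset_image_mulMap_iff hm0 hl hN]
  refine ⟨exists_perm_val_div_eq hm0 hl hN, fun δ hδ σ => ⟨fun hmix => ?_, ?_⟩⟩
  · by_contra hcon
    refine hmix fun U V hU _ hUne hVne => ?_
    obtain ⟨p, j, hj⟩ := exists_iterate_image_superset_cell hm σ hU hUne
    obtain ⟨q, hq⟩ := exists_iterate_markovStep_eq_univ hdvd (σ * δ)
      (fun 𝔅 h₁ h₂ h₃ => by_contra fun h₄ => hcon ⟨𝔅, h₁, h₄, h₂, h₃⟩) j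
    refine ⟨q + p, fun n hn => ?_⟩
    obtain ⟨r, rfl⟩ := Nat.exists_eq_add_of_le' hn
    have hall : (fun x => permMap N σ (mulMap m x))^[r + (q + p)] '' U = univ := by
      rw [← add_assoc, Function.iterate_add, image_comp]
      refine univ_subset_iff.1 (Subset.trans ?_ (image_mono hj))
      rw [iterate_image_preimage_cellIndex hm0 hl hN hδ, Function.iterate_add_apply, hq,
        Function.iterate_fixed (markovStep_univ _), preimage_univ]
    rw [hall, univ_inter]
    exact hVne
  · rintro ⟨𝔅, hp, hne, hst, hinv⟩ hmix
    obtain ⟨A, ⟨hA, h0⟩, -⟩ := hp.2 0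
    obtain ⟨U, hU, hUne, hUc⟩ := exists_isOpen_subset_cell (0 : ZMod N)
    have hev : ∀ k : ZMod N, ∀ᶠ n in Filter.atTop, k ∈ (markovStep ℓ (σ * δ))^[n] A := by
      intro k
      obtain ⟨V, hV, hVne, hVc⟩ := exists_isOpen_subset_cell k
      obtain ⟨n₀, hn₀⟩ := hmix U V hU hV hUne hVne
      refine Filter.eventually_atTop.2 ⟨n₀, fun n hn => ?_⟩
      obtain ⟨y, hyU, hyV⟩ := hn₀ n hn
      have hy : y ∈ cellIndex N ⁻¹' (markovStep ℓ (σ * δ))^[n] A := by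
        rw [← iterate_image_preimage_cellIndex hm0 hl hN hδ]
        refine image_mono (fun x hx => ?_) hyU
        rwa [mem_preimage, hUc x hx]
      rwa [mem_preimage, hVc y hyV] at hy
    obtain ⟨n, hn⟩ := (Filter.eventually_all.2 hev).exists
    exact univ_notMem_of_isPartition hp hne
      (eq_univ_of_forall hn ▸ iterate_markovStep_mem hdvd hst hinv hA n)
end

section
/- Let m ≥ 2 and ℓ ≥ 6 be integers and N = mℓ. Let p(ℓ,m) be the number of permutations σ of ℤ/Nℤ for which σ ∘ f is not topologically mixing, divided by N!. Then p(ℓ,m) < 11·(2e/ℓ)^{m−1}. In particular, for each fixed m ≥ 2, p(ℓ,m) → 0 as ℓ → ∞. -/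
open Set

/-- The number of permutations intertwining two colourings is at most the order of the
stabilizer of the first one. -/
theorem card_perm_comp_eq_le {α ι : Type*} [Fintype α] [DecidableEq α] [Fintype ι]
    [DecidableEq ι] (p q : α → ι) :
    Fintype.card {σ : Equiv.Perm α // p ∘ σ = q} ≤
      ∏ i, (Fintype.card {a // p a = i}).factorial := by
  by_cases h : Nonempty {σ : Equiv.Perm α // p ∘ σ = q}
  · obtain ⟨σ₀, h₀⟩ := h
    rw [← DomMulAct.stabilizer_card p]
    refine Fintype.card_le_of_injective
      (fun σ => ⟨σ.1 * σ₀⁻¹, ?_⟩) ?_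
    · funext x
      have h1 := congrFun (σ.2.trans h₀.symm) (σ₀⁻¹ x)
      simpa using h1
    · intro σ τ hστ
      simpa [Subtype.ext_iff] using hστ
  · rw [not_nonempty_iff] at h
    simp

/-- Colourings of `V` with prescribed class sizes are counted by a multinomial coefficient. -/
theorem card_colorings_mul_le {V ι : Type*} [Fintype V] [DecidableEq V] [Fintype ι]
    [DecidableEq ι] (s : ι → ℕ) :
    Fintype.card {c : V → ι // ∀ i, Fintype.card {v // c v = i} = s i} *
      ∏ i, (s i).factorial ≤ (Fintype.card V).factorial := by
  by_cases h : Nonempty {c : V → ι // ∀ i, Fintype.card {v // c v = i} = s i}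
  · obtain ⟨c₀, h₀⟩ := h
    have hg : ∀ c : {c : V → ι // ∀ i, Fintype.card {v // c v = i} = s i},
        ∃ g : Equiv.Perm V, c₀ ∘ g = c.1 := fun c =>
      ⟨Equiv.ofFiberEquiv (f := c.1) (g := c₀)
        (fun i => Fintype.equivOfCardEq ((c.2 i).trans (h₀ i).symm)),
        funext fun x => Equiv.ofFiberEquiv_map _ x⟩
    choose g hg using hg
    have hs : Fintype.card {σ : Equiv.Perm V // c₀ ∘ σ = c₀} = ∏ i, (s i).factorial := by
      rw [DomMulAct.stabilizer_card c₀]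
      simp only [h₀]
    rw [← hs, ← Fintype.card_prod, ← Fintype.card_perm]
    refine Fintype.card_le_of_injective (fun x => x.2.1 * g x.1) ?_
    rintro ⟨c, σ⟩ ⟨c', σ'⟩ hxy
    have key : ∀ (c : {c : V → ι // ∀ i, Fintype.card {v // c v = i} = s i})
        (σ : {σ : Equiv.Perm V // c₀ ∘ σ = c₀}), c₀ ∘ (σ.1 * g c : Equiv.Perm V) = c.1 := by
      intro c σ
      rw [Equiv.Perm.coe_mul, ← Function.comp_assoc, σ.2, hg]
    have hc : c = c' := Subtype.ext <| by
      rw [← key c σ, ← key c' σ']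
      exact congrArg (fun e : Equiv.Perm V => c₀ ∘ e) hxy
    subst hc
    have : σ = σ' := Subtype.ext (mul_right_cancel hxy)
    rw [this]
  · rw [not_nonempty_iff] at h
    simp

theorem card_fiber_comp {α V ι : Type*} [Fintype α] [Fintype V] [DecidableEq V]
    [DecidableEq ι] {r : α → V} {m : ℕ} (hr : ∀ v, Fintype.card {x // r x = v} = m)
    (c : V → ι) (i : ι) :
    Fintype.card {x // c (r x) = i} = m * Fintype.card {v // c v = i} := by
  classical
  rw [Fintype.card_subtype, Fintype.card_subtype,
    Finset.card_eq_sum_card_fiberwise (f := r) (t := Finset.univ.filter fun v => c v = i)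
      (fun x hx => by simpa using hx),
    Finset.sum_const_nat (m := m), mul_comm]
  intro v hv
  rw [← hr v, Fintype.card_subtype, Finset.filter_filter]
  congr 1
  ext x
  simp only [Finset.mem_filter, Finset.mem_univ, true_and] at hv ⊢
  exact ⟨fun h => h.2, fun h => ⟨h ▸ hv, h⟩⟩

/-- The permutations of the edge set which allow a colouring of the vertices with class sizes `s`
such that edges go from colour `i` to colour `τ i`. Here `b x` is the source of the edge `x`
and `r (σ x)` its target. -/
def colorable {α V ι : Type*} [Fintype V] [DecidableEq ι] (b r : α → V) (τ : ι → ι) (s : ι → ℕ) :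
    Set (Equiv.Perm α) :=
  {σ | ∃ c : V → ι, (∀ i, Fintype.card {v // c v = i} = s i) ∧
    ∀ x, c (r (σ x)) = τ (c (b x))}

theorem ncard_colorable_mul_le {α V ι : Type*} [Fintype α] [DecidableEq α] [Fintype V]
    [DecidableEq V] [Fintype ι] [DecidableEq ι] (b : α → V) {r : α → V} {m : ℕ}
    (hr : ∀ v, Fintype.card {x // r x = v} = m) (τ : ι → ι) (s : ι → ℕ) :
    (colorable b r τ s).ncard * ∏ i, (s i).factorial ≤
      (Fintype.card V).factorial * ∏ i, (m * s i).factorial := by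
  classical
  have h1 : (colorable b r τ s).ncard ≤
      Fintype.card {c : V → ι // ∀ i, Fintype.card {v // c v = i} = s i} *
        ∏ i, (m * s i).factorial := by
    rw [← Nat.card_coe_set_eq, Nat.card_eq_fintype_card]
    refine (Fintype.card_le_of_injective (β := Σ c : {c : V → ι //
      ∀ i, Fintype.card {v // c v = i} = s i},
        {σ : Equiv.Perm α // (c.1 ∘ r) ∘ σ = τ ∘ c.1 ∘ b})
      (fun σ => ⟨⟨σ.2.choose, σ.2.choose_spec.1⟩, ⟨σ.1, funext σ.2.choose_spec.2⟩⟩) ?_).trans ?_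
    · intro σ σ' h
      have := congrArg (fun z : (Σ c : {c : V → ι //
        ∀ i, Fintype.card {v // c v = i} = s i},
          {σ : Equiv.Perm α // (c.1 ∘ r) ∘ σ = τ ∘ c.1 ∘ b}) => z.2.1) h
      exact Subtype.ext this
    · rw [Fintype.card_sigma]
      refine (Finset.sum_le_card_nsmul _ _ (∏ i, (m * s i).factorial) ?_).trans ?_
      · intro c _
        refine (card_perm_comp_eq_le _ _).trans_eq ?_
        refine Finset.prod_congr rfl fun i _ => ?_
        have := card_fiber_comp hr c.1 i
        rw [c.2 i] at this
        rw [← this]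
        rfl
      · simp
  calc _ ≤ _ := Nat.mul_le_mul_right _ h1
    _ = _ := by ring
    _ ≤ _ := Nat.mul_le_mul_right _ (card_colorings_mul_le (V := V) s)

theorem choose_mul_choose_le_add_choose (a b c d : ℕ) :
    a.choose b * c.choose d ≤ (a + c).choose (b + d) := by
  rw [Nat.add_choose_eq]
  exact Finset.single_le_sum (f := fun ij : ℕ × ℕ => a.choose ij.1 * c.choose ij.2)
    (fun _ _ => Nat.zero_le _) (a := (b, d)) (by simp)

theorem choose_pow_le (a b m : ℕ) : a.choose b ^ m ≤ (m * a).choose (m * b) := by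
  induction m with
  | zero => simp
  | succ m ih =>
    rw [pow_succ, add_mul, add_mul, one_mul, one_mul]
    exact (Nat.mul_le_mul_right _ ih).trans (choose_mul_choose_le_add_choose _ _ _ _)

theorem mul_choose_pow_le_factorial {X a b r : ℕ}
    (h : X ≤ (a + b).choose a * (((r + 1) * a).factorial * ((r + 1) * b).factorial)) :
    X * (a + b).choose a ^ r ≤ ((r + 1) * (a + b)).factorial := by
  calc X * (a + b).choose a ^ r
      ≤ (a + b).choose a * (((r + 1) * a).factorial * ((r + 1) * b).factorial) *
          (a + b).choose a ^ r := Nat.mul_le_mul_right _ h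
    _ = (a + b).choose a ^ (r + 1) * (((r + 1) * a).factorial * ((r + 1) * b).factorial) := by
        ring
    _ ≤ ((r + 1) * (a + b)).choose ((r + 1) * a) *
          (((r + 1) * a).factorial * ((r + 1) * b).factorial) :=
        Nat.mul_le_mul_right _ (choose_pow_le _ _ _)
    _ = ((r + 1) * (a + b)).factorial := by
        rw [mul_add, ← Nat.add_choose_mul_factorial_mul_factorial, Nat.choose_symm_add]
        ring

theorem factorial_mul_pow_le (m n k : ℕ) (hm : 1 ≤ m) :
    (n * k).factorial * (m * k).factorial ^ n ≤ (m * (n * k)).factorial * k.factorial ^ n := by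
  induction n with
  | zero => simp
  | succ n ih =>
    have hC : (k + n * k).choose k ≤ (m * k + m * (n * k)).choose (m * k) := by
      rw [← mul_add]
      exact (Nat.le_self_pow (by omega) _).trans (choose_pow_le _ _ m)
    have e1 : ((n + 1) * k).factorial =
        (k + n * k).choose k * k.factorial * (n * k).factorial := by
      rw [add_mul, one_mul, add_comm (n * k), ← Nat.add_choose_mul_factorial_mul_factorial,
        Nat.choose_symm_add]
    have e2 : (m * ((n + 1) * k)).factorial =
        (m * k + m * (n * k)).choose (m * k) * (m * k).factorial * (m * (n * k)).factorial := by
      rw [add_mul, one_mul, add_comm (n * k), mul_add,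
        ← Nat.add_choose_mul_factorial_mul_factorial, Nat.choose_symm_add]
    rw [e1, e2]
    calc _ = (k + n * k).choose k * (k.factorial * (m * k).factorial) *
          ((n * k).factorial * (m * k).factorial ^ n) := by ring
      _ ≤ (m * k + m * (n * k)).choose (m * k) * (k.factorial * (m * k).factorial) *
          ((m * (n * k)).factorial * k.factorial ^ n) := by gcongr
      _ = _ := by ring

theorem ncard_colorable_bool_le {α V : Type*} [Fintype α] [DecidableEq α] [Fintype V]
    [DecidableEq V] (b : α → V) {r : α → V} {n k ℓ : ℕ} (hV : Fintype.card V = ℓ)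
    (hr : ∀ v, Fintype.card {x // r x = v} = n + 1) (hk : k ≤ ℓ) :
    (colorable b r id (fun i : Bool => if i then k else ℓ - k)).ncard * ℓ.choose k ^ n ≤
      ((n + 1) * ℓ).factorial := by
  have h := ncard_colorable_mul_le b hr id (fun i : Bool => if i then k else ℓ - k)
  obtain ⟨j, rfl⟩ := Nat.exists_eq_add_of_le hk
  simp only [Fintype.prod_bool, hV, if_true, Nat.add_sub_cancel_left, Bool.false_eq_true,
    if_false] at h ⊢
  refine mul_choose_pow_le_factorial ?_
  refine Nat.le_of_mul_le_mul_right (h.trans_eq ?_)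
    (Nat.mul_pos k.factorial_pos j.factorial_pos)
  rw [← Nat.add_choose_mul_factorial_mul_factorial k j, Nat.choose_symm_add]
  ring

theorem ncard_colorable_zmod_le {α V : Type*} [Fintype α] [DecidableEq α] [Fintype V]
    [DecidableEq V] (b : α → V) {r : α → V} {n k d : ℕ} [NeZero d] (hV : Fintype.card V = d * k)
    (hr : ∀ v, Fintype.card {x // r x = v} = n + 1) :
    (colorable b r (fun i : ZMod d => i + 1) (fun _ => k)).ncard * (d * k).choose k ^ n ≤
      ((n + 1) * (d * k)).factorial := by
  have h := ncard_colorable_mul_le b hr (fun i : ZMod d => i + 1) (fun _ => k)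
  simp only [Finset.prod_const, Finset.card_univ, ZMod.card, hV] at h
  obtain ⟨e, rfl⟩ := Nat.exists_eq_succ_of_ne_zero (NeZero.ne d)
  have hd : (e.succ) * k = k + e * k := by rw [Nat.succ_mul, add_comm]
  simp only [hd] at h ⊢
  refine mul_choose_pow_le_factorial ?_
  refine Nat.le_of_mul_le_mul_right (h.trans ?_) (Nat.pow_pos (n := e.succ) k.factorial_pos)
  have hf : (k + e * k).factorial = (k + e * k).choose k * k.factorial * (e * k).factorial := by
    rw [← Nat.add_choose_mul_factorial_mul_factorial, Nat.choose_symm_add]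
  rw [hf]
  calc _ = (k + e * k).choose k * k.factorial * ((n + 1) * k).factorial *
        ((e * k).factorial * ((n + 1) * k).factorial ^ e) := by rw [Nat.succ_eq_add_one]; ring
    _ ≤ (k + e * k).choose k * k.factorial * ((n + 1) * k).factorial *
        (((n + 1) * (e * k)).factorial * k.factorial ^ e) :=
        Nat.mul_le_mul_left _ (factorial_mul_pow_le _ _ _ (by omega))
    _ = _ := by rw [Nat.succ_eq_add_one]; ring

/-- The set of targets of edges with source in `A`, for the directed multigraph with edge set `α`,
vertex set `V`, source map `b` and target map `t`. -/
def outSet {α V : Type*} [Fintype α] [Fintype V] [DecidableEq V] (b t : α → V) (A : Finset V) :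
    Finset V :=
  Finset.univ.filter fun v => ∃ x, b x ∈ A ∧ t x = v

section Graph

variable {α V : Type*} [Fintype α] [Fintype V] [DecidableEq V] {b t : α → V} {m : ℕ}

theorem mem_outSet {A : Finset V} {v : V} : v ∈ outSet b t A ↔ ∃ x, b x ∈ A ∧ t x = v := by
  simp [outSet]

theorem card_filter_mem (hb : ∀ v, Fintype.card {x // b x = v} = m) (A : Finset V) :
    (Finset.univ.filter fun x => b x ∈ A).card = m * A.card := by
  have h := card_fiber_comp hb (fun v => decide (v ∈ A)) true
  simpa [Fintype.card_subtype] using h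

theorem card_le_card_of_forall (hb : ∀ v, Fintype.card {x // b x = v} = m)
    (ht : ∀ v, Fintype.card {x // t x = v} = m) (hm : 0 < m) {A B : Finset V}
    (h : ∀ x, b x ∈ A → t x ∈ B) : A.card ≤ B.card := by
  refine Nat.le_of_mul_le_mul_left ?_ hm
  rw [← card_filter_mem hb, ← card_filter_mem ht]
  refine Finset.card_le_card fun x hx => ?_
  simpa using h x (by simpa using hx)

theorem card_le_card_outSet (hb : ∀ v, Fintype.card {x // b x = v} = m)
    (ht : ∀ v, Fintype.card {x // t x = v} = m) (hm : 0 < m) (A : Finset V) :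
    A.card ≤ (outSet b t A).card :=
  card_le_card_of_forall hb ht hm fun x hx => mem_outSet.2 ⟨x, hx, rfl⟩

theorem mem_of_mem_outSet (hb : ∀ v, Fintype.card {x // b x = v} = m)
    (ht : ∀ v, Fintype.card {x // t x = v} = m) {A : Finset V}
    (hA : (outSet b t A).card = A.card) {x : α} (hx : t x ∈ outSet b t A) : b x ∈ A := by
  have hsub : (Finset.univ.filter fun x => b x ∈ A) ⊆
      Finset.univ.filter fun x => t x ∈ outSet b t A := by
    intro y hy
    simp only [Finset.mem_filter, Finset.mem_univ, true_and] at hy ⊢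
    exact mem_outSet.2 ⟨y, hy, rfl⟩
  have := Finset.eq_of_subset_of_card_le hsub
    (by rw [card_filter_mem hb, card_filter_mem ht, hA])
  have hx' : x ∈ Finset.univ.filter fun x => t x ∈ outSet b t A := by simpa using hx
  rw [← this] at hx'
  simpa using hx'

theorem outSet_inter (hb : ∀ v, Fintype.card {x // b x = v} = m)
    (ht : ∀ v, Fintype.card {x // t x = v} = m) (hm : 0 < m) {A B : Finset V}
    (hA : (outSet b t A).card = A.card) (hB : (outSet b t B).card = B.card) :
    outSet b t (A ∩ B) = outSet b t A ∩ outSet b t B ∧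
      (outSet b t (A ∩ B)).card = (A ∩ B).card := by
  have h1 : outSet b t (A ∩ B) ⊆ outSet b t A ∩ outSet b t B := by
    intro v hv
    obtain ⟨x, hx, rfl⟩ := mem_outSet.1 hv
    rw [Finset.mem_inter] at hx ⊢
    exact ⟨mem_outSet.2 ⟨x, hx.1, rfl⟩, mem_outSet.2 ⟨x, hx.2, rfl⟩⟩
  have h2 : (outSet b t A ∩ outSet b t B).card ≤ (A ∩ B).card := by
    refine card_le_card_of_forall ht hb hm fun x hx => ?_
    rw [Finset.mem_inter] at hx ⊢
    exact ⟨mem_of_mem_outSet hb ht hA hx.1, mem_of_mem_outSet hb ht hB hx.2⟩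
  have h3 := card_le_card_outSet hb ht hm (A ∩ B)
  have h4 := Finset.eq_of_subset_of_card_le h1 (h2.trans h3)
  exact ⟨h4, le_antisymm (h4 ▸ h2) h3⟩

theorem card_le_card_iterate_outSet (hb : ∀ v, Fintype.card {x // b x = v} = m)
    (ht : ∀ v, Fintype.card {x // t x = v} = m) (hm : 0 < m) (A : Finset V) (n : ℕ) :
    A.card ≤ ((outSet b t)^[n] A).card := by
  induction n with
  | zero => rfl
  | succ n ih =>
    rw [Function.iterate_succ_apply']
    exact ih.trans (card_le_card_outSet hb ht hm _)

theorem iterate_outSet_inter (hb : ∀ v, Fintype.card {x // b x = v} = m)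
    (ht : ∀ v, Fintype.card {x // t x = v} = m) (hm : 0 < m) {A B : Finset V}
    (hA : ∀ i, ((outSet b t)^[i] A).card = A.card)
    (hB : ∀ i, ((outSet b t)^[i] B).card = B.card) (i : ℕ) :
    (outSet b t)^[i] (A ∩ B) = (outSet b t)^[i] A ∩ (outSet b t)^[i] B ∧
      ((outSet b t)^[i] (A ∩ B)).card = (A ∩ B).card := by
  induction i with
  | zero => simp
  | succ i ih =>
    have h := outSet_inter hb ht hm (A := (outSet b t)^[i] A) (B := (outSet b t)^[i] B)
      (by rw [← Function.iterate_succ_apply' (outSet b t), hA, hA])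
      (by rw [← Function.iterate_succ_apply' (outSet b t), hB, hB])
    simp only [Function.iterate_succ_apply', ih.1]
    exact ⟨h.1, by rw [h.2, ← ih.1, ih.2]⟩

theorem exists_stable (hb : ∀ v, Fintype.card {x // b x = v} = m)
    (ht : ∀ v, Fintype.card {x // t x = v} = m) (hm : 0 < m) {a : V}
    (ha : ¬ ∃ n₀, ∀ n ≥ n₀, (outSet b t)^[n] {a} = Finset.univ) :
    ∃ S : Finset V, S.Nonempty ∧ S.card < Fintype.card V ∧
      ∀ i, ((outSet b t)^[i] S).card = S.card := by
  obtain ⟨_, ⟨n, rfl⟩, hmax⟩ := Set.exists_max_image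
    (Set.range fun n => (outSet b t)^[n] {a}) Finset.card (Set.toFinite _) ⟨_, 0, rfl⟩
  refine ⟨(outSet b t)^[n] {a}, ?_, ?_, fun i => ?_⟩
  · rw [← Finset.card_pos]
    exact lt_of_lt_of_le (by simp) (card_le_card_iterate_outSet hb ht hm {a} n)
  · by_contra! hge
    refine ha ⟨n, fun k hk => ?_⟩
    obtain ⟨i, rfl⟩ := Nat.exists_eq_add_of_le hk
    rw [← Finset.card_eq_iff_eq_univ]
    refine le_antisymm (Finset.card_le_univ _) (hge.trans ?_)
    rw [add_comm, Function.iterate_add_apply]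
    exact card_le_card_iterate_outSet hb ht hm _ _
  · refine le_antisymm ?_ (card_le_card_iterate_outSet hb ht hm _ _)
    rw [← Function.iterate_add_apply]
    exact hmax _ ⟨i + n, rfl⟩

theorem exists_periodic_disjoint (hb : ∀ v, Fintype.card {x // b x = v} = m)
    (ht : ∀ v, Fintype.card {x // t x = v} = m) (hm : 0 < m) {a : V}
    (ha : ¬ ∃ n₀, ∀ n ≥ n₀, (outSet b t)^[n] {a} = Finset.univ) :
    ∃ (T : Finset V) (d : ℕ), 0 < d ∧ T.Nonempty ∧ T.card < Fintype.card V ∧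
      (∀ i, ((outSet b t)^[i] T).card = T.card) ∧ (outSet b t)^[d] T = T ∧
      ∀ i j, i < d → j < d → ∀ v, v ∈ (outSet b t)^[i] T → v ∈ (outSet b t)^[j] T → i = j := by
  obtain ⟨S₀, hS₀, hS₀V, hS₀i⟩ := exists_stable hb ht hm ha
  obtain ⟨S, ⟨hS, hSi⟩, hmin⟩ := Set.exists_min_image
    {S : Finset V | S.Nonempty ∧ ∀ i, ((outSet b t)^[i] S).card = S.card} Finset.card
    (Set.toFinite _) ⟨S₀, hS₀, hS₀i⟩
  obtain ⟨i, j, hij, hij'⟩ : ∃ i j, i < j ∧ (outSet b t)^[i] S = (outSet b t)^[j] S := by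
    obtain ⟨i, j, hne, h⟩ := Finite.exists_ne_map_eq_of_infinite fun i => (outSet b t)^[i] S
    rcases hne.lt_or_gt with h' | h'
    exacts [⟨i, j, h', h⟩, ⟨j, i, h', h.symm⟩]
  set T := (outSet b t)^[i] S with hT
  have hTS : T.card = S.card := hSi i
  have hTi : ∀ k, ((outSet b t)^[k] T).card = T.card := fun k => by
    rw [hTS, hT, ← Function.iterate_add_apply, hSi]
  have hper : T ∈ Function.periodicPts (outSet b t) := by
    refine ⟨j - i, by omega, ?_⟩
    change (outSet b t)^[j - i] T = T
    rw [hT, ← Function.iterate_add_apply, Nat.sub_add_cancel hij.le, ← hij']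
  refine ⟨T, Function.minimalPeriod (outSet b t) T,
    Function.minimalPeriod_pos_of_mem_periodicPts hper, ?_, ?_, hTi,
    Function.isPeriodicPt_minimalPeriod _ _, ?_⟩
  · rw [← Finset.card_pos, hTS, Finset.card_pos]
    exact hS
  · rw [hTS]
    exact (hmin S₀ ⟨hS₀, hS₀i⟩).trans_lt hS₀V
  · intro p q hp hq v hvp hvq
    have hst : ∀ p i, ((outSet b t)^[i] ((outSet b t)^[p] T)).card =
        ((outSet b t)^[p] T).card := fun p i => by
      rw [← Function.iterate_add_apply, hTi, hTi]
    have hle := hmin ((outSet b t)^[p] T ∩ (outSet b t)^[q] T)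
      ⟨⟨v, Finset.mem_inter.2 ⟨hvp, hvq⟩⟩,
        fun i => (iterate_outSet_inter hb ht hm (hst p) (hst q) i).2⟩
    rw [← hTS] at hle
    have e1 := Finset.eq_of_subset_of_card_le
      (Finset.inter_subset_left (s₁ := (outSet b t)^[p] T) (s₂ := (outSet b t)^[q] T))
      ((hTi p).trans_le hle)
    have e2 := Finset.eq_of_subset_of_card_le
      (Finset.inter_subset_right (s₁ := (outSet b t)^[p] T) (s₂ := (outSet b t)^[q] T))
      ((hTi q).trans_le hle)
    exact (Function.iterate_eq_iterate_iff_of_lt_minimalPeriod hp hq).1 (e1.symm.trans e2)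

/-- A regular directed multigraph that is not primitive has either a proper closed set of vertices
or a cyclic partition of its vertices into classes of equal size. -/
theorem exists_coloring_of_not_primitive (hb : ∀ v, Fintype.card {x // b x = v} = m)
    (ht : ∀ v, Fintype.card {x // t x = v} = m) (hm : 0 < m) {a : V}
    (ha : ¬ ∃ n₀, ∀ n ≥ n₀, (outSet b t)^[n] {a} = Finset.univ) :
    ∃ k, 0 < k ∧ k < Fintype.card V ∧
      ((∃ c : V → Bool, (∀ i, Fintype.card {v // c v = i} =
          if i then k else Fintype.card V - k) ∧ ∀ x, c (t x) = c (b x)) ∨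
        ∃ d, 0 < d ∧ d * k = Fintype.card V ∧
          ∃ c : V → ZMod d, (∀ i, Fintype.card {v // c v = i} = k) ∧
            ∀ x, c (t x) = c (b x) + 1) := by
  obtain ⟨T, d, hd, hT, hTV, hTi, hper, hdisj⟩ := exists_periodic_disjoint hb ht hm ha
  classical
  set U := Finset.univ.filter fun v => ∃ i, v ∈ (outSet b t)^[i] T with hU
  have hmemU : ∀ v, v ∈ U ↔ ∃ i, v ∈ (outSet b t)^[i] T := by simp [hU]
  have hbt : ∀ i x, b x ∈ (outSet b t)^[i] T → t x ∈ (outSet b t)^[i + 1] T := by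
    intro i x hx
    rw [Function.iterate_succ_apply']
    exact mem_outSet.2 ⟨x, hx, rfl⟩
  by_cases hUV : U = Finset.univ
  · have : NeZero d := ⟨hd.ne'⟩
    have hmod : ∀ i, (outSet b t)^[i % d] T = (outSet b t)^[i] T := fun i =>
      Function.IsPeriodicPt.iterate_mod_apply hper i
    have hex : ∀ v, ∃ i, v ∈ (outSet b t)^[i] T := fun v => (hmemU v).1 (hUV ▸ Finset.mem_univ v)
    choose f hf using hex
    have hc : ∀ i v, v ∈ (outSet b t)^[i] T ↔ (f v : ZMod d) = i := by
      intro i v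
      rw [ZMod.natCast_eq_natCast_iff']
      constructor
      · intro h
        exact hdisj _ _ (Nat.mod_lt _ hd) (Nat.mod_lt _ hd) v
          ((hmod (f v)).symm ▸ hf v) ((hmod i).symm ▸ h)
      · intro h
        rw [← hmod, ← h, hmod]
        exact hf v
    have hcard : ∀ i : ZMod d, Fintype.card {v // (f v : ZMod d) = i} = T.card := by
      intro i
      rw [← hTi i.val, Fintype.card_subtype]
      congr 1
      ext v
      simp [hc]
    refine ⟨T.card, hT.card_pos, hTV, Or.inr ⟨d, hd, ?_, fun v => f v, hcard, fun x => ?_⟩⟩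
    · have h := Fintype.card_congr (Equiv.sigmaFiberEquiv fun v => (f v : ZMod d))
      rw [Fintype.card_sigma] at h
      simpa [hcard] using h
    · have := (hc _ _).1 (hbt _ x (hf (b x)))
      simpa using this
  · refine ⟨U.card, ?_, ?_, Or.inl ⟨fun v => decide (v ∈ U), ?_, fun x => ?_⟩⟩
    · obtain ⟨v, hv⟩ := hT
      exact Finset.card_pos.2 ⟨v, (hmemU v).2 ⟨0, hv⟩⟩
    · exact (Finset.card_lt_iff_ne_univ U).2 hUV
    · have h1 : Fintype.card {v // decide (v ∈ U) = true} = U.card := by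
        simp
      have h2 : Fintype.card {v // decide (v ∈ U) = false} = Fintype.card V - U.card := by
        rw [← Finset.card_compl, Fintype.card_subtype]
        congr 1
        ext v
        simp
      rintro (_ | _)
      · exact h2
      · exact h1
    · have hsub : outSet b t U ⊆ U := by
        intro v hv
        obtain ⟨x, hx, rfl⟩ := mem_outSet.1 hv
        obtain ⟨i, hi⟩ := (hmemU _).1 hx
        exact (hmemU _).2 ⟨i + 1, hbt i x hi⟩
      have heq := Finset.eq_of_subset_of_card_le hsub (card_le_card_outSet hb ht hm U)
      have : t x ∈ U ↔ b x ∈ U := by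
        constructor
        · intro h
          exact mem_of_mem_outSet hb ht (by rw [heq]) (heq.symm ▸ h)
        · intro h
          exact heq ▸ mem_outSet.2 ⟨x, h, rfl⟩
      simp [this]

end Graph

/-- The interval `[q/M, (q+1)/M)` of `[0,1)`. -/
def cyl (M q : ℕ) : Set (Set.Ico (0:ℝ) 1) :=
  {x | (q : ℝ) ≤ M * x.val ∧ M * x.val < q + 1}

theorem cyl_subset_image {N P m q : ℕ} [NeZero N] (hP : 0 < P) (hm : 0 < m)
    (hq : q < N * P * m) (σ : Equiv.Perm (ZMod N)) :
    cyl (N * P) (q % (N * P) % P + P * (σ ((q % (N * P) / P : ℕ) : ZMod N)).val) ⊆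
      (fun x => permMap N σ (mulMap m x)) '' cyl (N * P * m) q := by
  have hN : 0 < N := Nat.pos_of_ne_zero (NeZero.ne N)
  have hM : 0 < N * P := Nat.mul_pos hN hP
  set q₀ := q % (N * P) with hq₀
  have hq₀M : q₀ < N * P := Nat.mod_lt _ hM
  set j := q₀ / P with hj
  have hjN : j < N := Nat.div_lt_of_lt_mul (by rwa [mul_comm])
  set s := (σ (j : ZMod N)).val with hs
  rintro ⟨y, hy0, hy1⟩ ⟨hyl, hyr⟩
  simp only at hyl hyr
  have hNr : (0 : ℝ) < N := by exact_mod_cast hN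
  have hPr : (0 : ℝ) < P := by exact_mod_cast hP
  have hmr : (0 : ℝ) < m := by exact_mod_cast hm
  have hMr : (0 : ℝ) < (N : ℝ) * P := by positivity
  have hdec : (P : ℝ) * j + (q₀ % P : ℕ) = q₀ := by exact_mod_cast Nat.div_add_mod q₀ P
  have hdec' : ((N : ℝ) * P) * (q / (N * P) : ℕ) + q₀ = q := by
    exact_mod_cast Nat.div_add_mod q (N * P)
  push_cast at hyl hyr
  obtain ⟨z, hz⟩ : ∃ z : ℝ, z = y - ((s : ℝ) - j) / N := ⟨_, rfl⟩
  have hMz : (N : ℝ) * P * z = N * P * y - P * s + P * j := by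
    rw [hz]; field_simp; ring
  have hzl : (q₀ : ℝ) ≤ N * P * z := by rw [hMz]; linarith
  have hzr : (N : ℝ) * P * z < q₀ + 1 := by rw [hMz]; linarith
  have hq₀M' : (q₀ : ℝ) + 1 ≤ N * P := by exact_mod_cast hq₀M
  have hz0 : 0 ≤ z := by
    have : 0 ≤ (N : ℝ) * P * z := le_trans (Nat.cast_nonneg _) hzl
    exact nonneg_of_mul_nonneg_right this hMr
  have hz1 : z < 1 := by
    have : (N : ℝ) * P * z < N * P * 1 := by linarith
    exact lt_of_mul_lt_mul_left this hMr.le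
  have hfloor : ⌊(N : ℝ) * z⌋ = (j : ℤ) := by
    rw [Int.floor_eq_iff]
    have h1 : (P : ℝ) * j ≤ q₀ := by exact_mod_cast Nat.mul_div_le q₀ P
    have h2 : (q₀ : ℝ) + 1 ≤ P * (j + 1) := by
      have : q₀ + 1 ≤ P * (j + 1) := Nat.lt_mul_div_succ q₀ hP
      exact_mod_cast this
    constructor
    · push_cast
      refine le_of_mul_le_mul_left (a := (P : ℝ)) ?_ hPr
      linarith
    · push_cast
      refine lt_of_mul_lt_mul_left (a := (P : ℝ)) ?_ hPr.le
      linarith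
  have hqM : ((q / (N * P) : ℕ) : ℝ) + 1 ≤ m := by
    have : q / (N * P) < m := Nat.div_lt_of_lt_mul hq
    exact_mod_cast this
  have hx1 : (z + (q / (N * P) : ℕ)) / m < 1 := by
    rw [div_lt_one hmr]; linarith
  refine ⟨⟨(z + (q / (N * P) : ℕ)) / m, by positivity, hx1⟩, ?_, ?_⟩
  · have : ((N * P * m : ℕ) : ℝ) * ((z + (q / (N * P) : ℕ)) / m) =
        N * P * z + N * P * (q / (N * P) : ℕ) := by
      push_cast
      field_simp
    constructor
    · change (q : ℝ) ≤ ((N * P * m : ℕ) : ℝ) * ((z + (q / (N * P) : ℕ)) / m)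
      rw [this]; linarith
    · change ((N * P * m : ℕ) : ℝ) * ((z + (q / (N * P) : ℕ)) / m) < q + 1
      rw [this]; linarith
  · have hmul : (mulMap m ⟨(z + (q / (N * P) : ℕ)) / m, by positivity, hx1⟩).val = z := by
      change Int.fract ((m : ℝ) * ((z + (q / (N * P) : ℕ)) / m)) = z
      rw [mul_div_cancel₀ _ hmr.ne', Int.fract_add_natCast]
      exact Int.fract_eq_self.2 ⟨hz0, hz1⟩
    apply Subtype.ext
    change Int.fract _ = y
    rw [hmul, hfloor]
    simp only [Int.cast_natCast, ZMod.val_cast_of_lt hjN]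
    rw [← hs, hz, sub_add_cancel]
    exact Int.fract_eq_self.2 ⟨hy0, hy1⟩

theorem exists_cyl_subset_iterate_image {N m : ℕ} [NeZero N] (hm : 0 < m)
    (σ : Equiv.Perm (ZMod N)) (t : ℕ) {q : ℕ} (hq : q < N * m ^ t) :
    ∃ j : ZMod N, cyl N j.val ⊆
      (fun x => permMap N σ (mulMap m x))^[t] '' cyl (N * m ^ t) q := by
  induction t generalizing q with
  | zero =>
    refine ⟨(q : ZMod N), ?_⟩
    rw [ZMod.val_cast_of_lt (by simpa using hq)]
    simp
  | succ t ih =>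
    rw [pow_succ, ← mul_assoc] at hq ⊢
    have h := cyl_subset_image (pow_pos hm t) hm hq σ
    obtain ⟨j, hj⟩ := ih (q := q % (N * m ^ t) % m ^ t +
      m ^ t * (σ ((q % (N * m ^ t) / m ^ t : ℕ) : ZMod N)).val) (by
        have h1 := Nat.mod_lt (q % (N * m ^ t)) (pow_pos hm t)
        have h2 := ZMod.val_lt (σ ((q % (N * m ^ t) / m ^ t : ℕ) : ZMod N))
        calc _ < m ^ t + m ^ t * (σ ((q % (N * m ^ t) / m ^ t : ℕ) : ZMod N)).val := by omega
          _ = m ^ t * ((σ ((q % (N * m ^ t) / m ^ t : ℕ) : ZMod N)).val + 1) := by ring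
          _ ≤ m ^ t * N := Nat.mul_le_mul_left _ h2
          _ = _ := mul_comm _ _)
    refine ⟨j, hj.trans ?_⟩
    rw [Function.iterate_succ, Set.image_comp]
    exact Set.image_mono h

section BlockGraph

variable {m ℓ : ℕ} [NeZero ℓ]

/-- The index modulo `ℓ` of the block `{m * a, …, m * a + m - 1}` containing `x`. -/
def blockIdx (m ℓ : ℕ) [NeZero ℓ] (x : ZMod (m * ℓ)) : Fin ℓ := Fin.ofNat ℓ (x.val / m)

/-- The reduction of `x` modulo `ℓ`. -/
def residue (m ℓ : ℕ) [NeZero ℓ] (x : ZMod (m * ℓ)) : Fin ℓ := Fin.ofNat ℓ x.val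

theorem val_blockIdx [NeZero m] (x : ZMod (m * ℓ)) : (blockIdx m ℓ x).val = x.val / m :=
  Nat.mod_eq_of_lt (Nat.div_lt_of_lt_mul (ZMod.val_lt x))

theorem val_residue (x : ZMod (m * ℓ)) : (residue m ℓ x).val = x.val % ℓ := rfl

theorem card_blockIdx_fiber [NeZero m] (v : Fin ℓ) :
    Fintype.card {x : ZMod (m * ℓ) // blockIdx m ℓ x = v} = m := by
  have hm : 0 < m := Nat.pos_of_ne_zero (NeZero.ne m)
  have hlt : ∀ a : Fin m, m * v.val + a.val < m * ℓ := fun a =>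
    calc m * v.val + a.val < m * (v.val + 1) := by rw [mul_add]; omega
      _ ≤ m * ℓ := Nat.mul_le_mul_left _ v.isLt
  have hmem : ∀ a : Fin m, blockIdx m ℓ ((m * v.val + a.val : ℕ) : ZMod (m * ℓ)) = v := by
    intro a
    apply Fin.ext
    rw [val_blockIdx, ZMod.val_cast_of_lt (hlt a), Nat.mul_add_div hm, Nat.div_eq_of_lt a.isLt,
      add_zero]
  refine (Fintype.card_congr (β := Fin m)
    { toFun := fun x => ⟨x.1.val % m, Nat.mod_lt _ hm⟩
      invFun := fun a => ⟨((m * v.val + a.val : ℕ) : ZMod (m * ℓ)), hmem a⟩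
      left_inv := ?_
      right_inv := ?_ }).trans (Fintype.card_fin m)
  · rintro ⟨x, rfl⟩
    apply Subtype.ext
    simp only [val_blockIdx, Nat.div_add_mod, ZMod.natCast_val, ZMod.cast_id', id]
  · intro a
    apply Fin.ext
    simp only [ZMod.val_cast_of_lt (hlt a), Nat.mul_add_mod, Nat.mod_eq_of_lt a.isLt]

theorem card_residue_fiber [NeZero m] (v : Fin ℓ) :
    Fintype.card {x : ZMod (m * ℓ) // residue m ℓ x = v} = m := by
  have hℓ : 0 < ℓ := Nat.pos_of_ne_zero (NeZero.ne ℓ)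
  have hlt : ∀ a : Fin m, ℓ * a.val + v.val < m * ℓ := fun a =>
    calc ℓ * a.val + v.val < ℓ * (a.val + 1) := by rw [mul_add]; omega
      _ ≤ ℓ * m := Nat.mul_le_mul_left _ a.isLt
      _ = m * ℓ := mul_comm _ _
  have hmem : ∀ a : Fin m, residue m ℓ ((ℓ * a.val + v.val : ℕ) : ZMod (m * ℓ)) = v := by
    intro a
    apply Fin.ext
    rw [val_residue, ZMod.val_cast_of_lt (hlt a), Nat.mul_add_mod, Nat.mod_eq_of_lt v.isLt]
  refine (Fintype.card_congr (β := Fin m)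
    { toFun := fun x => ⟨x.1.val / ℓ, Nat.div_lt_of_lt_mul
        ((ZMod.val_lt x.1).trans_eq (mul_comm _ _))⟩
      invFun := fun a => ⟨((ℓ * a.val + v.val : ℕ) : ZMod (m * ℓ)), hmem a⟩
      left_inv := ?_
      right_inv := ?_ }).trans (Fintype.card_fin m)
  · rintro ⟨x, rfl⟩
    apply Subtype.ext
    simp only [val_residue, Nat.div_add_mod, ZMod.natCast_val, ZMod.cast_id', id]
  · intro a
    apply Fin.ext
    simp only [ZMod.val_cast_of_lt (hlt a), Nat.mul_add_div hℓ, Nat.div_eq_of_lt v.isLt, add_zero]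

theorem cyl_subset_image_of_blockIdx_eq [NeZero m] (σ : Equiv.Perm (ZMod (m * ℓ)))
    {j y : ZMod (m * ℓ)} (h : blockIdx m ℓ y = residue m ℓ j) :
    cyl (m * ℓ) (σ y).val ⊆
      (fun x => permMap (m * ℓ) σ (mulMap m x)) '' cyl (m * ℓ) j.val := by
  have hm : 0 < m := Nat.pos_of_ne_zero (NeZero.ne m)
  have hd := Nat.mod_lt y.val hm
  have hdiv : y.val / m = j.val % ℓ := by rw [← val_blockIdx, h, val_residue]
  have hq : m * j.val + y.val % m < m * ℓ * 1 * m := by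
    have := ZMod.val_lt j
    calc _ < m * (j.val + 1) := by rw [mul_add]; omega
      _ ≤ m * (m * ℓ) := Nat.mul_le_mul_left _ this
      _ = _ := by ring
  have hmod : (m * j.val + y.val % m) % (m * ℓ) = y.val := by
    conv_rhs => rw [← Nat.mod_eq_of_lt (ZMod.val_lt y), ← Nat.div_add_mod y.val m, hdiv]
    rw [Nat.add_mod, Nat.add_mod (m * (j.val % ℓ)), Nat.mul_mod_mul_left, Nat.mul_mod_mul_left,
      Nat.mod_mod]
  have hsub := cyl_subset_image one_pos hm hq σ
  simp only [mul_one, hmod, Nat.mod_one, one_mul, Nat.div_one, zero_add, ZMod.natCast_val,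
    ZMod.cast_id', id] at hsub
  refine hsub.trans (Set.image_mono ?_)
  rintro x ⟨hx1, hx2⟩
  have hmr : (0 : ℝ) < m := by exact_mod_cast hm
  have hdr : ((y.val % m : ℕ) : ℝ) + 1 ≤ m := by exact_mod_cast hd
  have hd0 : (0 : ℝ) ≤ ((y.val % m : ℕ) : ℝ) := Nat.cast_nonneg _
  rw [Nat.cast_mul (m * ℓ) m, Nat.cast_add, Nat.cast_mul m j.val] at hx1 hx2
  constructor
  · refine le_of_mul_le_mul_left (a := (m : ℝ)) ?_ hmr
    linarith
  · refine lt_of_mul_lt_mul_left (a := (m : ℝ)) ?_ hmr.le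
    linarith

theorem cyl_subset_iterate_image_of_mem [NeZero m] (σ : Equiv.Perm (ZMod (m * ℓ)))
    (j : ZMod (m * ℓ)) (n : ℕ) (k : ZMod (m * ℓ))
    (h : blockIdx m ℓ k ∈
      (outSet (blockIdx m ℓ) (fun x => residue m ℓ (σ x)))^[n] {residue m ℓ j}) :
    cyl (m * ℓ) (σ k).val ⊆
      (fun x => permMap (m * ℓ) σ (mulMap m x))^[n + 1] '' cyl (m * ℓ) j.val := by
  induction n generalizing k with
  | zero => exact cyl_subset_image_of_blockIdx_eq σ (by simpa using h)
  | succ n ih =>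
    rw [Function.iterate_succ_apply'] at h
    obtain ⟨y, hy, hyk⟩ := mem_outSet.1 h
    rw [Function.iterate_succ', Set.image_comp]
    exact (cyl_subset_image_of_blockIdx_eq σ hyk.symm).trans (Set.image_mono (ih y hy))

theorem topMixing_of_primitive [NeZero m] (hm : 2 ≤ m) (σ : Equiv.Perm (ZMod (m * ℓ)))
    (h : ∀ a, ∃ n₀, ∀ n ≥ n₀,
      (outSet (blockIdx m ℓ) (fun x => residue m ℓ (σ x)))^[n] {a} = Finset.univ) :
    TopMixing (fun x => permMap (m * ℓ) σ (mulMap m x)) := by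
  have hm0 : 0 < m := by omega
  have hN : 0 < m * ℓ := Nat.pos_of_ne_zero (NeZero.ne _)
  have hNr : (1 : ℝ) ≤ (m * ℓ : ℕ) := by exact_mod_cast hN
  rintro U V hU - ⟨x, hx⟩ ⟨y, hy⟩
  obtain ⟨ε, hε, hball⟩ := Metric.isOpen_iff.1 hU x hx
  obtain ⟨t, ht⟩ := pow_unbounded_of_one_lt (1 / ε) (show (1 : ℝ) < m by exact_mod_cast hm)
  have hMr : (0 : ℝ) < (m * ℓ * m ^ t : ℕ) := by
    exact_mod_cast Nat.mul_pos hN (pow_pos hm0 t)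
  have hMε : 1 < (m * ℓ * m ^ t : ℕ) * ε := by
    rw [div_lt_iff₀ hε] at ht
    rw [Nat.cast_mul, Nat.cast_pow]
    have : (0 : ℝ) < (m : ℝ) ^ t * ε := by linarith
    nlinarith
  obtain ⟨j, hj⟩ := exists_cyl_subset_iterate_image (N := m * ℓ) hm0 σ t
    (q := ⌊((m * ℓ * m ^ t : ℕ) : ℝ) * x.val⌋₊) (by
      rw [Nat.floor_lt (mul_nonneg hMr.le x.2.1)]
      nlinarith [x.2.2])
  have hsubU : cyl (m * ℓ * m ^ t) ⌊((m * ℓ * m ^ t : ℕ) : ℝ) * x.val⌋₊ ⊆ U := by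
    rintro z ⟨hz1, hz2⟩
    apply hball
    rw [Metric.mem_ball, Subtype.dist_eq, Real.dist_eq]
    have h1 := Nat.floor_le (mul_nonneg hMr.le x.2.1)
    have h2 := Nat.lt_floor_add_one (((m * ℓ * m ^ t : ℕ) : ℝ) * x.val)
    refine lt_of_mul_lt_mul_left (a := ((m * ℓ * m ^ t : ℕ) : ℝ)) ?_ hMr.le
    refine lt_trans ?_ hMε
    have habs : ((m * ℓ * m ^ t : ℕ) : ℝ) * |z.val - x.val| =
        |((m * ℓ * m ^ t : ℕ) : ℝ) * (z.val - x.val)| := by rw [abs_mul, abs_of_pos hMr]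
    rw [habs, abs_lt, mul_sub]
    constructor <;> linarith
  obtain ⟨k, hk⟩ : ∃ k : ZMod (m * ℓ), y ∈ cyl (m * ℓ) (σ k).val := by
    have hlt : ⌊((m * ℓ : ℕ) : ℝ) * y.val⌋₊ < m * ℓ := by
      rw [Nat.floor_lt (mul_nonneg (by linarith) y.2.1)]
      nlinarith [y.2.2]
    refine ⟨σ.symm (⌊((m * ℓ : ℕ) : ℝ) * y.val⌋₊ : ZMod (m * ℓ)), ?_⟩
    rw [Equiv.apply_symm_apply, ZMod.val_cast_of_lt hlt]
    exact ⟨Nat.floor_le (mul_nonneg (by linarith) y.2.1), Nat.lt_floor_add_one _⟩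
  obtain ⟨n₀, hn₀⟩ := h (residue m ℓ j)
  refine ⟨n₀ + 1 + t, fun n hn => ⟨y, ?_, hy⟩⟩
  obtain ⟨i, rfl⟩ := Nat.exists_eq_add_of_le hn
  rw [show n₀ + 1 + t + i = (n₀ + i + 1) + t by ring, Function.iterate_add, Set.image_comp]
  refine Set.image_mono (hj.trans (Set.image_mono hsubU)) ?_
  refine cyl_subset_iterate_image_of_mem σ j (n₀ + i) k ?_ hk
  rw [hn₀ _ (Nat.le_add_right _ _)]
  exact Finset.mem_univ _

end BlockGraph

theorem add_le_choose {j k : ℕ} (hj : 1 ≤ j) (hk : 1 ≤ k) : j + k ≤ (j + k).choose k := by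
  induction k, hk using Nat.le_induction with
  | base => simp
  | succ k _ ih =>
    rw [← add_assoc, Nat.choose_succ_succ']
    have : 0 < (j + k).choose (k + 1) := Nat.choose_pos (by omega)
    omega

theorem add_mul_pred_le_two_mul_choose {j k : ℕ} (hj : 2 ≤ j) (hk : 2 ≤ k) :
    (j + k) * (j + k - 1) ≤ 2 * (j + k).choose k := by
  induction k, hk using Nat.le_induction with
  | base => rw [Nat.choose_two_right, Nat.mul_div_cancel' (Nat.even_mul_pred_self _).two_dvd]
  | succ k _ ih =>
    obtain ⟨i, rfl⟩ := Nat.exists_eq_add_of_le hj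
    have h : 2 + i + k ≤ (2 + i + k).choose (k + 1) := by
      have := add_le_choose (j := 1 + i) (k := k + 1) (by omega) (by omega)
      rwa [show 1 + i + (k + 1) = 2 + i + k by ring] at this
    rw [← add_assoc, Nat.choose_succ_succ', Nat.add_sub_cancel]
    have e : 2 + i + k - 1 = 1 + i + k := by omega
    rw [e] at ih
    calc (2 + i + k + 1) * (2 + i + k) = (2 + i + k) * (1 + i + k) + 2 * (2 + i + k) := by ring
      _ ≤ 2 * (2 + i + k).choose k + 2 * (2 + i + k).choose (k + 1) := by gcongr
      _ = _ := by ring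

theorem inv_choose_pow_le {ℓ k r : ℕ} (hr : 1 ≤ r) (hℓ : 6 ≤ ℓ) (hk : 0 < k) (hkℓ : k < ℓ) :
    ((ℓ.choose k : ℝ) ^ r)⁻¹ ≤
      ((ℓ : ℝ) ^ r)⁻¹ * (2 / (ℓ - 1) + (if k = 1 then 1 else 0) +
        (if k = ℓ - 1 then 1 else 0)) := by
  have hℓr : (6 : ℝ) ≤ ℓ := by exact_mod_cast hℓ
  have hpos : (0 : ℝ) < ((ℓ : ℝ) ^ r)⁻¹ := by positivity
  have h2 : (0 : ℝ) < 2 / ((ℓ : ℝ) - 1) := div_pos two_pos (by linarith)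
  obtain ⟨j, rfl⟩ := Nat.exists_eq_add_of_le' hkℓ.le
  by_cases h : k = 1 ∨ k = j + k - 1
  · have h1 : (((j + k).choose k : ℝ) ^ r)⁻¹ ≤ (((j + k : ℕ) : ℝ) ^ r)⁻¹ := by
      have : ((j + k : ℕ) : ℝ) ≤ (j + k).choose k := by
        exact_mod_cast add_le_choose (by omega) hk
      gcongr
    refine h1.trans (le_mul_of_one_le_right hpos.le ?_)
    rcases h with h | h
    · rw [if_pos h]
      split_ifs <;> linarith
    · rw [if_pos h]
      split_ifs <;> linarith
  · push Not at h
    rw [if_neg h.1, if_neg h.2, add_zero, add_zero]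
    have hc : ((j + k : ℕ) : ℝ) * ((((j + k : ℕ) : ℝ) - 1) / 2) ≤ (j + k).choose k := by
      have := add_mul_pred_le_two_mul_choose (j := j) (k := k) (by omega) (by omega)
      have h' : ((j + k : ℕ) : ℝ) * (((j + k : ℕ) : ℝ) - 1) ≤ 2 * (j + k).choose k := by
        rw [← Nat.cast_pred (by omega)]
        exact_mod_cast this
      linarith
    have hh : (1 : ℝ) ≤ (((j + k : ℕ) : ℝ) - 1) / 2 := by linarith
    calc (((j + k).choose k : ℝ) ^ r)⁻¹
        ≤ ((((j + k : ℕ) : ℝ) * ((((j + k : ℕ) : ℝ) - 1) / 2)) ^ r)⁻¹ := by gcongr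
      _ = (((j + k : ℕ) : ℝ) ^ r)⁻¹ * (((((j + k : ℕ) : ℝ) - 1) / 2) ^ r)⁻¹ := by
          rw [mul_pow, mul_inv]
      _ ≤ (((j + k : ℕ) : ℝ) ^ r)⁻¹ * ((((j + k : ℕ) : ℝ) - 1) / 2)⁻¹ := by
          gcongr
          exact le_self_pow₀ hh (by omega)
      _ = _ := by rw [inv_div]

theorem sum_inv_choose_pow_le {ℓ r : ℕ} (hr : 1 ≤ r) (hℓ : 6 ≤ ℓ) :
    ∑ k ∈ Finset.Ioo 0 ℓ, ((ℓ.choose k : ℝ) ^ r)⁻¹ ≤ 4 * ((ℓ : ℝ) ^ r)⁻¹ := by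
  have hℓr : (6 : ℝ) ≤ ℓ := by exact_mod_cast hℓ
  refine (Finset.sum_le_sum fun k hk => ?_).trans_eq (b := ∑ k ∈ Finset.Ioo 0 ℓ,
    ((ℓ : ℝ) ^ r)⁻¹ * (2 / (ℓ - 1) + (if k = 1 then 1 else 0) +
        (if k = ℓ - 1 then 1 else 0))) ?_
  · rw [Finset.mem_Ioo] at hk
    exact inv_choose_pow_le hr hℓ hk.1 hk.2
  · rw [← Finset.mul_sum, Finset.sum_add_distrib, Finset.sum_add_distrib, Finset.sum_const,
      Finset.sum_ite_eq', Finset.sum_ite_eq', if_pos (by rw [Finset.mem_Ioo]; omega),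
      if_pos (by rw [Finset.mem_Ioo]; omega), Nat.card_Ioo, Nat.sub_zero, nsmul_eq_mul,
      Nat.cast_pred (by omega), mul_div_cancel₀ _ (by linarith)]
    ring

/-- The permutations with a cyclic colouring of the vertices with classes of size `k`. -/
def cyclicColorable {α V : Type*} [Fintype V] (b r : α → V) (k : ℕ) : Set (Equiv.Perm α) :=
  {σ | ∃ d, 0 < d ∧ d * k = Fintype.card V ∧
    σ ∈ colorable b r (fun i : ZMod d => i + 1) (fun _ => k)}

theorem ncard_cyclicColorable_le {α V : Type*} [Fintype α] [DecidableEq α] [Fintype V]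
    [DecidableEq V] (b : α → V) {r : α → V} {n k : ℕ} (hk : 0 < k)
    (hr : ∀ v, Fintype.card {x // r x = v} = n + 1) :
    (cyclicColorable b r k).ncard * (Fintype.card V).choose k ^ n ≤
      ((n + 1) * Fintype.card V).factorial := by
  by_cases h : ∃ d, 0 < d ∧ d * k = Fintype.card V
  · obtain ⟨d, hd, hdk⟩ := h
    have : NeZero d := ⟨hd.ne'⟩
    have hsub : cyclicColorable b r k ⊆
        colorable b r (fun i : ZMod d => i + 1) (fun _ => k) := by
      rintro σ ⟨e, -, hek, hσ⟩
      obtain rfl : e = d := Nat.eq_of_mul_eq_mul_right hk (hek.trans hdk.symm)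
      exact hσ
    have h := ncard_colorable_zmod_le b hdk.symm hr
    rw [hdk] at h
    exact (Nat.mul_le_mul_right _ (Set.ncard_le_ncard hsub (Set.toFinite _))).trans h
  · have : cyclicColorable b r k = ∅ :=
      Set.eq_empty_of_forall_notMem fun σ ⟨d, hd, hdk, _⟩ => h ⟨d, hd, hdk⟩
    simp [this]

theorem not_topMixing_subset {m ℓ : ℕ} [NeZero ℓ] (hm : 2 ≤ m) :
    {σ : Equiv.Perm (ZMod (m * ℓ)) |
      ¬ TopMixing (fun x => permMap (m * ℓ) σ (mulMap m x))} ⊆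
    ⋃ k ∈ Finset.Ioo 0 ℓ,
      (colorable (blockIdx m ℓ) (residue m ℓ) id (fun i : Bool => if i then k else ℓ - k) ∪
        cyclicColorable (blockIdx m ℓ) (residue m ℓ) k) := by
  have : NeZero m := ⟨by omega⟩
  intro σ hσ
  have h := mt (topMixing_of_primitive hm σ) hσ
  rw [not_forall] at h
  obtain ⟨a, ha⟩ := h
  have ht : ∀ v, Fintype.card {x // residue m ℓ (σ x) = v} = m := fun v =>
    (Fintype.card_congr (σ.subtypeEquiv fun _ => Iff.rfl)).trans (card_residue_fiber (m := m) v)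
  obtain ⟨k, hk, hkℓ, h⟩ := exists_coloring_of_not_primitive
    (card_blockIdx_fiber (m := m)) ht (by omega) ha
  rw [Fintype.card_fin] at hkℓ
  simp only [Set.mem_iUnion, Finset.mem_Ioo]
  refine ⟨k, ⟨hk, hkℓ⟩, ?_⟩
  rcases h with ⟨c, hc, hcσ⟩ | h
  · exact Or.inl ⟨c, fun i => by simpa using hc i, hcσ⟩
  · exact Or.inr h

theorem ncard_not_topMixing_le {m ℓ : ℕ} (hm : 2 ≤ m) (hℓ : 6 ≤ ℓ) :
    ({σ : Equiv.Perm (ZMod (m * ℓ)) |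
      ¬ TopMixing (fun x => permMap (m * ℓ) σ (mulMap m x))}.ncard : ℝ) /
        ((m * ℓ).factorial : ℝ) ≤ 8 * ((ℓ : ℝ) ^ (m - 1))⁻¹ := by
  have : NeZero ℓ := ⟨by omega⟩
  have : NeZero m := ⟨by omega⟩
  obtain ⟨n, rfl⟩ : ∃ n, m = n + 1 := ⟨m - 1, by omega⟩
  rw [Nat.add_sub_cancel]
  have hF : (0 : ℝ) < (((n + 1) * ℓ).factorial : ℝ) := by exact_mod_cast Nat.factorial_pos _
  have hle := (Set.ncard_le_ncard (not_topMixing_subset (ℓ := ℓ) hm) (Set.toFinite _)).trans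
    (Finset.set_ncard_biUnion_le _ _)
  have hterm : ∀ k ∈ Finset.Ioo 0 ℓ,
      (((colorable (blockIdx (n + 1) ℓ) (residue (n + 1) ℓ) id
          (fun i : Bool => if i then k else ℓ - k) ∪
        cyclicColorable (blockIdx (n + 1) ℓ) (residue (n + 1) ℓ) k).ncard : ℕ) : ℝ) ≤
      ((n + 1) * ℓ).factorial * (2 * ((ℓ.choose k : ℝ) ^ n)⁻¹) := by
    intro k hk
    rw [Finset.mem_Ioo] at hk
    have hC : (0 : ℝ) < (ℓ.choose k : ℝ) ^ n := by
      have := Nat.choose_pos hk.2.le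
      positivity
    have h1 := ncard_colorable_bool_le (blockIdx (n + 1) ℓ) (Fintype.card_fin ℓ)
      (card_residue_fiber (m := n + 1)) hk.2.le
    have h2 := ncard_cyclicColorable_le (blockIdx (n + 1) ℓ) hk.1
      (card_residue_fiber (m := n + 1))
    rw [Fintype.card_fin] at h2
    have h3 := Nat.mul_le_mul_right (ℓ.choose k ^ n) (Set.ncard_union_le
      (colorable (blockIdx (n + 1) ℓ) (residue (n + 1) ℓ) id
          (fun i : Bool => if i then k else ℓ - k))
      (cyclicColorable (blockIdx (n + 1) ℓ) (residue (n + 1) ℓ) k))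
    have h4 := (h3.trans_eq (Nat.add_mul _ _ _)).trans (Nat.add_le_add h1 h2)
    rw [← mul_assoc, ← div_eq_mul_inv, le_div_iff₀ hC, mul_two]
    exact_mod_cast h4
  have hle' := (Nat.cast_le (α := ℝ)).2 hle
  rw [Nat.cast_sum] at hle'
  rw [div_le_iff₀ hF]
  calc _ ≤ _ := hle'.trans (Finset.sum_le_sum hterm)
    _ = ((n + 1) * ℓ).factorial * (2 * ∑ k ∈ Finset.Ioo 0 ℓ, ((ℓ.choose k : ℝ) ^ n)⁻¹) := by
      rw [← Finset.mul_sum, ← Finset.mul_sum]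
    _ ≤ ((n + 1) * ℓ).factorial * (2 * (4 * ((ℓ : ℝ) ^ n)⁻¹)) := by
      gcongr
      exact sum_inv_choose_pow_le (by omega) hℓ
    _ = _ := by ring

/-- for `N = mℓ`, `ℓ ≥ 6`, the proportion of permutations `σ` for which
`σ ∘ f` is not mixing is less than `11 (2e/ℓ)^(m-1)`; in particular it tends to `0`
as `ℓ → ∞`. -/
theorem stmt2 (m : ℕ) (hm : 2 ≤ m) :
    (∀ ℓ : ℕ, 6 ≤ ℓ →
      ({σ : Equiv.Perm (ZMod (m * ℓ)) |
          ¬ TopMixing (fun x => permMap (m * ℓ) σ (mulMap m x))}.ncard : ℝ)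
          / ((m * ℓ).factorial : ℝ)
        < 11 * (2 * Real.exp 1 / (ℓ : ℝ)) ^ (m - 1)) ∧
    Filter.Tendsto
      (fun ℓ : ℕ =>
        ({σ : Equiv.Perm (ZMod (m * ℓ)) |
            ¬ TopMixing (fun x => permMap (m * ℓ) σ (mulMap m x))}.ncard : ℝ)
          / ((m * ℓ).factorial : ℝ))
      Filter.atTop (nhds 0) := by
  have hbound : ∀ ℓ : ℕ, 6 ≤ ℓ →
      ({σ : Equiv.Perm (ZMod (m * ℓ)) |
          ¬ TopMixing (fun x => permMap (m * ℓ) σ (mulMap m x))}.ncard : ℝ)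
          / ((m * ℓ).factorial : ℝ)
        < 11 * (2 * Real.exp 1 / (ℓ : ℝ)) ^ (m - 1) := by
    intro ℓ hℓ
    refine (ncard_not_topMixing_le hm hℓ).trans_lt ?_
    have hℓ' : (0 : ℝ) < ((ℓ : ℝ) ^ (m - 1))⁻¹ := by
      have : (0 : ℝ) < ℓ := by exact_mod_cast (by omega : 0 < ℓ)
      positivity
    have he : (1 : ℝ) ≤ (2 * Real.exp 1) ^ (m - 1) := by
      refine one_le_pow₀ ?_
      linarith [Real.one_le_exp zero_le_one]
    rw [div_pow, div_eq_mul_inv]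
    nlinarith
  refine ⟨hbound, ?_⟩
  have hlim : Filter.Tendsto (fun ℓ : ℕ => 11 * (2 * Real.exp 1 / (ℓ : ℝ)) ^ (m - 1))
      Filter.atTop (nhds 0) := by
    have h := (((tendsto_const_div_atTop_nhds_zero_nat (2 * Real.exp 1)).pow (m - 1)).const_mul 11)
    rwa [zero_pow (by omega), mul_zero] at h
  refine tendsto_of_tendsto_of_tendsto_of_le_of_le' tendsto_const_nhds hlim
    (Filter.Eventually.of_forall fun ℓ => by positivity) ?_
  filter_upwards [Filter.eventually_ge_atTop 6] with ℓ hℓ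
  exact (hbound ℓ hℓ).le
end

section
/- Let m ≥ 2 and N ≥ 2 be integers. For every subset A of ℤ/Nℤ, ♯A ≤ ♯f̃(A) ≤ m·♯A, where ♯ denotes cardinality. -/
open Set

/-- Each residue has at most `m` representations `m * a + d` with `a : ZMod N` and `d < m`. -/
theorem card_filter_mul_add_eq_le (m N : ℕ) [NeZero N] (A : Finset (ZMod N)) (b : ZMod N) :
    ((A ×ˢ Finset.range m).filter
      (fun p => (m : ZMod N) * p.1 + (p.2 : ZMod N) = b)).card ≤ m := by
  have hN : 0 < N := Nat.pos_of_ne_zero (NeZero.ne N)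
  conv_rhs => rw [← Finset.card_range m]
  refine Finset.card_le_card_of_injOn (fun p => (m * p.1.val + p.2) / N) ?_ ?_
  · rintro ⟨a, d⟩ h
    simp only [Finset.coe_filter, Finset.mem_product, Finset.mem_range, mem_ofPred_eq] at h
    simp only [Finset.coe_range, mem_Iio]
    rw [Nat.div_lt_iff_lt_mul hN]
    have ha : a.val + 1 ≤ N := ZMod.val_lt a
    have := Nat.mul_le_mul_left m ha
    rw [Nat.mul_add] at this
    omega
  · rintro ⟨a, d⟩ h ⟨a', d'⟩ h' heq
    simp only [Finset.coe_filter, Finset.mem_product, Finset.mem_range, mem_ofPred_eq] at h h'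
    obtain ⟨⟨-, hd⟩, hb⟩ := h
    obtain ⟨⟨-, hd'⟩, hb'⟩ := h'
    have hmod : (m * a.val + d) % N = (m * a'.val + d') % N := by
      rw [← Nat.ModEq, ← ZMod.natCast_eq_natCast_iff]
      push_cast
      rw [ZMod.natCast_zmod_val, ZMod.natCast_zmod_val, hb, hb']
    have key : m * a.val + d = m * a'.val + d' := by
      rw [← Nat.div_add_mod (m * a.val + d) N, ← Nat.div_add_mod (m * a'.val + d') N, hmod]
      exact congrArg (fun q => N * q + _) heq
    have hm : 0 < m := by omega
    have hval : a.val = a'.val := by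
      have := congrArg (· / m) key
      simpa [Nat.mul_add_div hm, Nat.div_eq_of_lt hd, Nat.div_eq_of_lt hd'] using this
    have hdd : d = d' := by
      rw [hval] at key
      omega
    rw [ZMod.val_injective N hval, hdd]

/-- `♯A ≤ ♯f̃(A) ≤ m ♯A`. -/
theorem stmt4 (m N : ℕ) (hm : 2 ≤ m) (hN : 2 ≤ N) (A : Set (ZMod N)) :
    A.ncard ≤ (ftil m N A).ncard ∧ (ftil m N A).ncard ≤ m * A.ncard := by
  classical
  have : NeZero N := ⟨by omega⟩
  lift A to Finset (ZMod N) using A.toFinite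
  set g : ZMod N × ℕ → ZMod N := fun p => (m : ZMod N) * p.1 + (p.2 : ZMod N) with hg
  have himage : ftil m N A = ((A ×ˢ Finset.range m).image g : Finset (ZMod N)) := by
    ext b
    simp only [ftil, hg, mem_ofPred_eq, Finset.coe_image, mem_image, Finset.mem_coe,
      Finset.mem_product, Finset.mem_range, Prod.exists]
    constructor
    · rintro ⟨a, ha, d, hd, rfl⟩
      exact ⟨a, d, ⟨ha, hd⟩, rfl⟩
    · rintro ⟨a, d, ⟨ha, hd⟩, rfl⟩
      exact ⟨a, ha, d, hd, rfl⟩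
  have hcard : (A ×ˢ Finset.range m).card = m * A.card := by
    rw [Finset.card_product, Finset.card_range, Nat.mul_comm]
  rw [himage, ncard_coe_finset, ncard_coe_finset]
  constructor
  · have := Finset.card_le_mul_card_image_of_maps_to
      (fun p hp => Finset.mem_image_of_mem g hp) m
      (fun b _ => card_filter_mul_add_eq_le m N A b)
    rw [hcard] at this
    exact Nat.le_of_mul_le_mul_left this (by omega)
  · exact Finset.card_image_le.trans hcard.le
end

section
/- Let m ≥ 2 and N ≥ 2 be integers, and let A ⊆ ℤ/Nℤ satisfy 0 < ♯A < N. Then ♯f̃(A) = ♯A if and only if both of the following hold: (i) N = mℓ for some integer ℓ, and (ii) A is a union of cosets of the subgroup ℓℤ/Nℤ of ℤ/Nℤ (that is, j ∈ A implies j + ℓ ∈ A for all j ∈ ℤ/Nℤ). -/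
open Set

theorem natCast_mem_ftil {m N : ℕ} (hm : 0 < m) {A : Set (ZMod N)} {x : ℕ}
    (hx : ((x / m : ℕ) : ZMod N) ∈ A) : (x : ZMod N) ∈ ftil m N A := by
  refine ⟨_, hx, x % m, Nat.mod_lt _ hm, ?_⟩
  exact_mod_cast congrArg (Nat.cast : ℕ → ZMod N) (Nat.div_add_mod x m).symm

/-- Write `b.val + k * N` in base `m`. -/
def divModMap (m N : ℕ) (hm : 0 < m) (p : ZMod N × Fin m) : ZMod N × Fin m :=
  (((p.1.val + p.2 * N) / m : ℕ), ⟨(p.1.val + p.2 * N) % m, Nat.mod_lt _ hm⟩)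

theorem divModMap_bijective (m N : ℕ) [NeZero N] (hm : 0 < m) :
    Function.Bijective (divModMap m N hm) := by
  refine Function.Surjective.bijective_of_finite ?_
  rintro ⟨a, d, hd⟩
  have hN : 0 < N := NeZero.pos N
  have hlt : (m * a.val + d) / N < m := by
    rw [Nat.div_lt_iff_lt_mul hN]
    nlinarith [ZMod.val_lt a]
  refine ⟨(((m * a.val + d : ℕ) : ZMod N), ⟨(m * a.val + d) / N, hlt⟩), ?_⟩
  have hx : ((m * a.val + d : ℕ) : ZMod N).val + (m * a.val + d) / N * N = m * a.val + d := by
    rw [ZMod.val_natCast, Nat.mod_add_div']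
  simp only [divModMap, hx, Prod.mk.injEq, Fin.mk.injEq]
  constructor
  · rw [Nat.mul_add_div hm, Nat.div_eq_of_lt hd, add_zero, ZMod.natCast_zmod_val]
  · rw [Nat.mul_add_mod, Nat.mod_eq_of_lt hd]

/-- `♯f̃(A) = ♯A` exactly when every preimage of a point of `f̃(A)` lies in `A`. -/
theorem ncard_ftil_eq_iff {m N : ℕ} [NeZero N] (hm : 0 < m) (A : Set (ZMod N)) :
    (ftil m N A).ncard = A.ncard ↔
      ∀ x : ℕ, (x : ZMod N) ∈ ftil m N A → ((x / m : ℕ) : ZMod N) ∈ A := by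
  set T : Set (ZMod N × Fin m) := divModMap m N hm ⁻¹' (A ×ˢ univ) with hT
  have hTcard : T.ncard = A.ncard * m := by
    rw [hT, Set.ncard_preimage_of_injective_subset_range (divModMap_bijective m N hm).1
      (by simp [(divModMap_bijective m N hm).2.range_eq]), Set.ncard_prod]
    simp [Set.ncard_univ]
  have hBcard : (ftil m N A ×ˢ (univ : Set (Fin m))).ncard = (ftil m N A).ncard * m := by
    simp [Set.ncard_prod, Set.ncard_univ]
  have hsub : T ⊆ ftil m N A ×ˢ univ := by
    rintro ⟨b, k⟩ h
    refine ⟨?_, mem_univ _⟩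
    simpa using natCast_mem_ftil hm h.1
  constructor
  · intro h x hx
    have hmem : ((x : ZMod N), (⟨x / N % m, Nat.mod_lt _ hm⟩ : Fin m)) ∈ T := by
      rw [Set.eq_of_subset_of_ncard_le hsub (by rw [hTcard, hBcard, h])]
      exact ⟨hx, mem_univ _⟩
    have hy : (((x % N + x / N % m * N) / m : ℕ) : ZMod N) ∈ A := by
      simpa [hT, divModMap, ZMod.val_natCast] using hmem
    have hxy : x = (x % N + x / N % m * N) + m * (N * (x / N / m)) := by
      have h1 := Nat.mod_add_div x N
      have h2 := Nat.mod_add_div (x / N) m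
      nlinarith
    rw [hxy, Nat.add_mul_div_left _ _ hm]
    simpa using hy
  · intro h
    have hEq : T = ftil m N A ×ˢ univ := by
      refine hsub.antisymm ?_
      rintro ⟨b, k⟩ ⟨hb, -⟩
      exact ⟨h _ (by simpa using hb), mem_univ _⟩
    exact Nat.eq_of_mul_eq_mul_right hm (by rw [← hBcard, ← hEq, hTcard])

theorem add_nsmul_mem_of_forall_add_mem {M : Type*} [AddMonoid M] {A : Set M} {c : M}
    (h : ∀ j ∈ A, j + c ∈ A) {a : M} (ha : a ∈ A) (t : ℕ) : a + t • c ∈ A := by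
  induction t with
  | zero => simpa using ha
  | succ t ih => rw [succ_nsmul, ← add_assoc]; exact h _ ih

/-- for `0 < ♯A < N`, `♯f̃(A) = ♯A` iff `N = mℓ` for some `ℓ` and `A` is a
union of cosets of `ℓℤ/Nℤ`. -/
theorem stmt5 (m N : ℕ) (hm : 2 ≤ m) (hN : 2 ≤ N) (A : Set (ZMod N))
    (h0 : 0 < A.ncard) (h1 : A.ncard < N) :
    (ftil m N A).ncard = A.ncard ↔
      ∃ ℓ : ℕ, N = m * ℓ ∧ ∀ j : ZMod N, j ∈ A → j + (ℓ : ZMod N) ∈ A := by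
  have : NeZero N := ⟨by omega⟩
  have hm0 : 0 < m := by omega
  rw [ncard_ftil_eq_iff hm0]
  constructor
  · intro h
    have step : ∀ d < m, ∀ j ∈ A, j + (((N + d) / m : ℕ) : ZMod N) ∈ A := by
      intro d hd j hj
      have hmem := h (m * j.val + (N + d)) ⟨j, hj, d, hd, by simp⟩
      rw [Nat.mul_add_div hm0] at hmem
      simpa using hmem
    have hq := step 0 hm0
    rw [add_zero] at hq
    by_cases hdvd : m ∣ N
    · exact ⟨N / m, (Nat.mul_div_cancel' hdvd).symm, hq⟩
    · exfalso
      have hdiv : (N + (m - 1)) / m = N / m + 1 := by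
        have hr : 0 < N % m := Nat.pos_of_ne_zero fun h => hdvd (Nat.dvd_of_mod_eq_zero h)
        have hlt := Nat.mod_lt N hm0
        have hx : N + (m - 1) = (N % m - 1) + m * (N / m + 1) := by
          have := Nat.mod_add_div N m
          rw [mul_add]
          omega
        rw [hx, Nat.add_mul_div_left _ _ hm0, Nat.div_eq_of_lt (by omega), zero_add]
      have hone : ∀ j ∈ A, j + 1 ∈ A := by
        intro j hj
        have h2 := step (m - 1) (by omega) j hj
        rw [hdiv] at h2
        have h3 := add_nsmul_mem_of_forall_add_mem hq h2 (N - 1)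
        have h4 : ((N - 1 : ℕ) : ZMod N) = -1 := by
          rw [Nat.cast_sub (by omega)]; simp
        rw [nsmul_eq_mul, h4] at h3
        convert h3 using 1
        push_cast
        ring
      obtain ⟨a, ha⟩ := Set.nonempty_of_ncard_ne_zero h0.ne'
      have huniv : A = univ := by
        refine Set.eq_univ_of_forall fun x => ?_
        simpa using add_nsmul_mem_of_forall_add_mem hone ha (x - a).val
      rw [huniv, Set.ncard_univ, Nat.card_zmod] at h1
      exact h1.ne rfl
  · rintro ⟨ℓ, hℓ, hA⟩ x ⟨a, ha, d, hd, hx⟩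
    have hmod : x ≡ m * a.val + d [MOD m * ℓ] := by
      rw [← hℓ, ← ZMod.natCast_eq_natCast_iff]
      simpa using hx
    have hxd : x % m = d := by
      have := hmod.of_mul_right ℓ
      rwa [Nat.ModEq, Nat.mul_add_mod, Nat.mod_eq_of_lt hd] at this
    have hdiv : x / m ≡ a.val [MOD ℓ] := by
      refine Nat.ModEq.mul_left_cancel' hm0.ne' (Nat.ModEq.add_right_cancel' d ?_)
      rwa [← hxd, Nat.div_add_mod, hxd]
    have hle : a.val ≤ x / m + N * a.val := by
      nlinarith [Nat.zero_le (x / m), Nat.zero_le a.val]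
    have hdvd : ℓ ∣ x / m + N * a.val - a.val := by
      refine (Nat.modEq_iff_dvd' hle).1 (hdiv.symm.trans ?_)
      have hN0 : N * a.val ≡ 0 [MOD ℓ] :=
        Nat.modEq_zero_iff_dvd.2 (Dvd.dvd.mul_right ⟨m, by rw [hℓ, mul_comm]⟩ _)
      exact (hN0.add_left (x / m)).symm
    obtain ⟨t, ht⟩ := hdvd
    have hcast : ((x / m : ℕ) : ZMod N) = a + t • (ℓ : ZMod N) := by
      have := congrArg (Nat.cast : ℕ → ZMod N) ((Nat.sub_eq_iff_eq_add hle).1 ht)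
      push_cast [ZMod.natCast_self, ZMod.natCast_zmod_val] at this
      rw [nsmul_eq_mul]
      simp only [zero_mul, add_zero] at this
      rw [this]
      ring
    rw [hcast]
    exact add_nsmul_mem_of_forall_add_mem hA ha t
end

section
/- Let m ≥ 2 and N ≥ 2 be integers, let σ be a permutation of ℤ/Nℤ, and let g = σ ∘ f. Then g fails to be topologically mixing if and only if there is some nonempty proper subset A of ℤ/Nℤ such that ♯(g̃^r(A)) = ♯A for all r ≥ 0, where g̃^r denotes the r-fold iterate of g̃. -/
open Set

/-- The point of the subinterval `I_j` at relative position `t`. -/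
noncomputable def subPoint (N : ℕ) [NeZero N] (j : ZMod N) (t : Set.Ico (0:ℝ) 1) :
    Set.Ico (0:ℝ) 1 :=
  ⟨(j.val + t.val) / N, by
    have hN : (0:ℝ) < N := by exact_mod_cast Nat.pos_of_neZero N
    have hj : (j.val : ℝ) + 1 ≤ N := by exact_mod_cast ZMod.val_lt j
    have h0 := t.2.1
    have h1 := t.2.2
    constructor
    · positivity
    · rw [div_lt_one hN]; linarith⟩

/-- The index of the subinterval containing `x`. -/
noncomputable def subIndex (N : ℕ) (x : Set.Ico (0:ℝ) 1) : ZMod N :=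
  ((⌊(N : ℝ) * x.val⌋ : ℤ) : ZMod N)

section Coordinates

variable {N : ℕ} [NeZero N]

lemma mul_subPoint (j : ZMod N) (t : Set.Ico (0:ℝ) 1) :
    (N : ℝ) * (subPoint N j t).val = j.val + t.val := by
  have hN : (N : ℝ) ≠ 0 := NeZero.ne _
  simp only [subPoint]
  field_simp

lemma fract01_add_div (k : ℤ) (t : Set.Ico (0:ℝ) 1) :
    fract01 ((k + t.val) / N) = subPoint N (k : ZMod N) t := by
  have hN : (N : ℝ) ≠ 0 := NeZero.ne _
  apply Subtype.ext
  change Int.fract _ = _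
  rw [Int.fract_eq_iff]
  refine ⟨(subPoint N (k : ZMod N) t).2.1, (subPoint N (k : ZMod N) t).2.2, k / N, ?_⟩
  have hv : (((k : ZMod N).val : ℤ) : ℝ) = ((k % N : ℤ) : ℝ) := by rw [ZMod.val_intCast]
  have hk : ((N * (k / N) + k % N : ℤ) : ℝ) = (k : ℝ) := by rw [Int.mul_ediv_add_emod]
  push_cast at hv hk
  simp only [subPoint]
  field_simp
  rw [hv]
  linarith

lemma subIndex_subPoint (j : ZMod N) (t : Set.Ico (0:ℝ) 1) :
    subIndex N (subPoint N j t) = j := by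
  have h : ⌊(j.val : ℝ) + t.val⌋ = (j.val : ℤ) := by
    rw [Int.floor_eq_iff]
    have h0 := t.2.1
    have h1 := t.2.2
    push_cast
    constructor <;> linarith
  rw [subIndex, mul_subPoint, h]
  simp

lemma subPoint_subIndex (x : Set.Ico (0:ℝ) 1) :
    subPoint N (subIndex N x) (fract01 (N * x.val)) = x := by
  have hN : (N : ℝ) ≠ 0 := NeZero.ne _
  rw [subIndex, ← fract01_add_div]
  apply Subtype.ext
  change Int.fract ((_ + Int.fract _) / _) = _
  rw [Int.floor_add_fract, mul_div_cancel_left₀ _ hN]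
  exact Int.fract_eq_self.2 x.2

lemma exists_eq_subPoint (x : Set.Ico (0:ℝ) 1) :
    ∃ t, x = subPoint N (subIndex N x) t :=
  ⟨_, (subPoint_subIndex x).symm⟩

lemma permMap_subPoint (σ : Equiv.Perm (ZMod N)) (j : ZMod N) (t : Set.Ico (0:ℝ) 1) :
    permMap N σ (subPoint N j t) = subPoint N (σ j) t := by
  have h := subIndex_subPoint j t
  rw [subIndex] at h
  rw [permMap, h]
  have := fract01_add_div (N := N) ((σ j).val : ℤ) t
  rw [Int.cast_natCast, Int.cast_natCast, ZMod.natCast_zmod_val] at this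
  rw [← this]
  congr 1
  simp only [subPoint]
  ring

lemma mulMap_subPoint (m : ℕ) (j : ZMod N) (t : Set.Ico (0:ℝ) 1) :
    mulMap m (subPoint N j t) =
      subPoint N (m * j + (⌊(m : ℝ) * t.val⌋ : ℤ)) (mulMap m t) := by
  have := fract01_add_div (N := N) (m * j.val + ⌊(m : ℝ) * t.val⌋ : ℤ) (mulMap m t)
  push_cast at this
  rw [ZMod.natCast_zmod_val] at this
  rw [← this, mulMap]
  congr 1
  have h : (mulMap m t).val = Int.fract ((m : ℝ) * t.val) := rfl
  rw [h, add_assoc, Int.floor_add_fract]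
  simp only [subPoint]
  ring

end Coordinates

/-- The induced map on sets of indices. -/
def indexStep (m N : ℕ) (σ : Equiv.Perm (ZMod N)) (A : Set (ZMod N)) : Set (ZMod N) :=
  ⇑σ '' ftil m N A

lemma indexStep_mono {m N : ℕ} (σ : Equiv.Perm (ZMod N)) : Monotone (indexStep m N σ) := by
  rintro A B h _ ⟨_, ⟨a, ha, d, hd, rfl⟩, rfl⟩
  exact mem_image_of_mem _ ⟨a, h ha, d, hd, rfl⟩

/-- The map `g = σ ∘ f`. -/
noncomputable def permMul (m N : ℕ) (σ : Equiv.Perm (ZMod N)) (x : Set.Ico (0:ℝ) 1) :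
    Set.Ico (0:ℝ) 1 :=
  permMap N σ (mulMap m x)

/-- The inverse branch `s ↦ (d + s) / m` of `mulMap m`. -/
noncomputable def mulBranch (m d : ℕ) (hd : d < m) (s : Set.Ico (0:ℝ) 1) : Set.Ico (0:ℝ) 1 :=
  ⟨(d + s.val) / m, by
    have hm : (0:ℝ) < m := by exact_mod_cast (Nat.zero_le d).trans_lt hd
    have hj : (d : ℝ) + 1 ≤ m := by exact_mod_cast hd
    have h0 := s.2.1
    have h1 := s.2.2
    constructor
    · positivity
    · rw [div_lt_one hm]; linarith⟩

section Dynamics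

variable {m N : ℕ} [NeZero N] (σ : Equiv.Perm (ZMod N))

lemma permMul_subPoint (j : ZMod N) (t : Set.Ico (0:ℝ) 1) :
    permMul m N σ (subPoint N j t) =
      subPoint N (σ (m * j + (⌊(m : ℝ) * t.val⌋ : ℤ))) (mulMap m t) := by
  rw [permMul, mulMap_subPoint, permMap_subPoint]

lemma permMul_subPoint_mulBranch (j : ZMod N) {d : ℕ} (hd : d < m) (s : Set.Ico (0:ℝ) 1) :
    permMul m N σ (subPoint N j (mulBranch m d hd s)) = subPoint N (σ (m * j + d)) s := by
  have hm : (m : ℝ) ≠ 0 := by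
    have : m ≠ 0 := by omega
    exact_mod_cast this
  have h : (m : ℝ) * (mulBranch m d hd s).val = d + s.val := by
    simp only [mulBranch]
    field_simp
  have hf : ⌊(d : ℝ) + s.val⌋ = (d : ℤ) := by
    rw [Int.floor_eq_iff]
    have h0 := s.2.1
    have h1 := s.2.2
    push_cast
    constructor <;> linarith
  have hs : mulMap m (mulBranch m d hd s) = s := by
    apply Subtype.ext
    change Int.fract _ = _
    rw [h, Int.fract_natCast_add, Int.fract_eq_self]
    exact s.2
  rw [permMul_subPoint, h, hf, hs, Int.cast_natCast]

lemma exists_digit (hm : 0 < m) (t : Set.Ico (0:ℝ) 1) :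
    ∃ (d : ℕ) (hd : d < m) (s : Set.Ico (0:ℝ) 1), t = mulBranch m d hd s := by
  have hm' : (0:ℝ) < m := by exact_mod_cast hm
  have h0 : 0 ≤ (m : ℝ) * t.val := mul_nonneg hm'.le t.2.1
  have h1 : (m : ℝ) * t.val < m := by nlinarith [t.2.2]
  refine ⟨⌊(m : ℝ) * t.val⌋₊, (Nat.floor_lt h0).2 h1, mulMap m t, ?_⟩
  apply Subtype.ext
  change t.val = (_ + Int.fract _) / _
  rw [natCast_floor_eq_intCast_floor h0, Int.floor_add_fract, mul_div_cancel_left₀ _ hm'.ne']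

lemma permMul_image_subIndex_preimage (hm : 0 < m) (A : Set (ZMod N)) :
    permMul m N σ '' (subIndex N ⁻¹' A) = subIndex N ⁻¹' indexStep m N σ A := by
  ext y
  constructor
  · rintro ⟨x, hx, rfl⟩
    obtain ⟨t, ht⟩ := exists_eq_subPoint (N := N) x
    obtain ⟨d, hd, s, rfl⟩ := exists_digit hm t
    rw [ht, mem_preimage, permMul_subPoint_mulBranch, subIndex_subPoint]
    exact mem_image_of_mem _ ⟨_, hx, d, hd, rfl⟩
  · rintro ⟨b, ⟨a, ha, d, hd, rfl⟩, hb⟩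
    obtain ⟨s, hs⟩ := exists_eq_subPoint (N := N) y
    refine ⟨subPoint N a (mulBranch m d hd s), ?_, ?_⟩
    · rwa [mem_preimage, subIndex_subPoint]
    · rw [permMul_subPoint_mulBranch, hb, ← hs]

lemma iterate_permMul_image_subIndex_preimage (hm : 0 < m) (n : ℕ) (A : Set (ZMod N)) :
    (permMul m N σ)^[n] '' (subIndex N ⁻¹' A) = subIndex N ⁻¹' (indexStep m N σ)^[n] A := by
  induction n generalizing A with
  | zero => simp
  | succ n ih =>
    rw [Function.iterate_succ, image_comp, permMul_image_subIndex_preimage σ hm, ih,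
      Function.iterate_succ_apply]

lemma exists_permMul_eq (hm : 0 < m) (x y : Set.Ico (0:ℝ) 1)
    (h : subIndex N y = subIndex N (permMul m N σ x)) :
    ∃ z, permMul m N σ z = y ∧ subIndex N z = subIndex N x ∧
      |z.val - x.val| = |y.val - (permMul m N σ x).val| / m := by
  have hm' : (0:ℝ) < m := by exact_mod_cast hm
  have hN : (0:ℝ) < N := by exact_mod_cast Nat.pos_of_neZero N
  obtain ⟨t, ht⟩ := exists_eq_subPoint (N := N) x
  obtain ⟨d, hd, s, rfl⟩ := exists_digit hm t
  obtain ⟨u, hu⟩ := exists_eq_subPoint (N := N) y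
  generalize subIndex N x = j at ht
  subst ht
  rw [h, permMul_subPoint_mulBranch, subIndex_subPoint] at hu
  refine ⟨subPoint N j (mulBranch m d hd u), ?_, ?_, ?_⟩
  · rw [permMul_subPoint_mulBranch, hu]
  · rw [subIndex_subPoint]
  · rw [permMul_subPoint_mulBranch, hu, ← abs_of_pos hm', ← abs_div]
    congr 1
    simp only [subPoint, mulBranch]
    field_simp
    ring

lemma exists_iterate_permMul_eq (hm : 0 < m) (n : ℕ) (x y : Set.Ico (0:ℝ) 1)
    (h : subIndex N y = subIndex N ((permMul m N σ)^[n] x)) :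
    ∃ z, (permMul m N σ)^[n] z = y ∧ subIndex N z = subIndex N x ∧
      |z.val - x.val| ≤ (1 / (m : ℝ)) ^ n := by
  have hm' : (0:ℝ) < m := by exact_mod_cast hm
  induction n generalizing x with
  | zero =>
    refine ⟨y, rfl, h, ?_⟩
    rw [pow_zero, abs_le]
    constructor <;> linarith [x.2.1, x.2.2, y.2.1, y.2.2]
  | succ n ih =>
    obtain ⟨w, hw, hwi, hwd⟩ := ih (permMul m N σ x) h
    obtain ⟨z, hz, hzi, hzd⟩ := exists_permMul_eq σ hm x w hwi
    refine ⟨z, ?_, hzi, ?_⟩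
    · rw [Function.iterate_succ_apply, hz, hw]
    · rw [hzd, pow_succ, ← div_eq_mul_one_div]
      gcongr

lemma IsOpen.exists_subIndex_preimage_subset_iterate_image (hm : 2 ≤ m)
    {U : Set (Set.Ico (0:ℝ) 1)} (hU : IsOpen U) (hne : U.Nonempty) :
    ∃ (n : ℕ) (j : ZMod N), subIndex N ⁻¹' {j} ⊆ (permMul m N σ)^[n] '' U := by
  obtain ⟨x, hx⟩ := hne
  obtain ⟨ε, hε, hb⟩ := Metric.isOpen_iff.1 hU x hx
  have hm' : (1:ℝ) < m := by exact_mod_cast hm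
  obtain ⟨n, hn⟩ := exists_pow_lt_of_lt_one hε ((div_lt_one (by linarith)).2 hm')
  refine ⟨n, subIndex N ((permMul m N σ)^[n] x), fun y hy => ?_⟩
  obtain ⟨z, hz, -, hd⟩ := exists_iterate_permMul_eq σ (by omega) n x y hy
  refine ⟨z, hb ?_, hz⟩
  rw [Metric.mem_ball, Subtype.dist_eq, Real.dist_eq]
  exact hd.trans_lt hn

lemma exists_isOpen_subset_subIndex_preimage (j : ZMod N) :
    ∃ U : Set (Set.Ico (0:ℝ) 1), IsOpen U ∧ U.Nonempty ∧ U ⊆ subIndex N ⁻¹' {j} := by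
  refine ⟨{x | (j.val : ℝ) < N * x.val ∧ N * x.val < j.val + 1}, ?_, ?_, ?_⟩
  · have hc : Continuous fun x : Set.Ico (0:ℝ) 1 => (N : ℝ) * x.val := by fun_prop
    exact (isOpen_lt continuous_const hc).inter (isOpen_lt hc continuous_const)
  · refine ⟨subPoint N j ⟨1 / 2, by norm_num, by norm_num⟩, ?_⟩
    rw [mem_ofPred_eq, mul_subPoint]
    constructor <;> norm_num
  · rintro x ⟨h0, h1⟩
    have h : ⌊(N : ℝ) * x.val⌋ = (j.val : ℤ) := by
      rw [Int.floor_eq_iff]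
      push_cast
      exact ⟨h0.le, h1⟩
    rw [mem_preimage, subIndex, h]
    simp

lemma ftil_univ (hm : 0 < m) : ftil m N univ = univ := by
  refine eq_univ_of_forall fun b => ⟨(b.val / m : ℕ), mem_univ _, b.val % m, Nat.mod_lt _ hm, ?_⟩
  rw [← Nat.cast_mul, ← Nat.cast_add, Nat.div_add_mod, ZMod.natCast_zmod_val]

lemma indexStep_univ (hm : 0 < m) : indexStep m N σ univ = univ := by
  rw [indexStep, ftil_univ hm, image_univ, σ.range_eq_univ]

lemma ncard_le_ncard_ftil (hm : 0 < m) (A : Set (ZMod N)) : A.ncard ≤ (ftil m N A).ncard := by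
  have h : (A ×ˢ Iio m).ncard ≤ (ftil m N A ×ˢ Iio m).ncard := by
    refine ncard_le_ncard_of_injOn
      (fun p => ((m : ZMod N) * p.1 + p.2, (m * p.1.val + p.2) / N)) ?_ ?_
      ((toFinite _).prod (finite_Iio m))
    · rintro ⟨a, d⟩ ⟨ha, hd⟩
      refine ⟨⟨a, ha, d, hd, rfl⟩, ?_⟩
      have hd : d < m := hd
      have ha := ZMod.val_lt a
      change _ / N < m
      rw [Nat.div_lt_iff_lt_mul (Nat.pos_of_neZero N)]
      nlinarith
    · rintro ⟨a, d⟩ ⟨-, hd⟩ ⟨b, e⟩ ⟨-, he⟩ heq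
      have hd : d < m := hd
      have he : e < m := he
      obtain ⟨h1, h2⟩ := Prod.mk.inj heq
      have h3 : ((m * a.val + d : ℕ) : ZMod N) = (m * b.val + e : ℕ) := by
        push_cast
        rwa [ZMod.natCast_zmod_val, ZMod.natCast_zmod_val]
      rw [ZMod.natCast_eq_natCast_iff'] at h3
      have h4 : m * a.val + d = m * b.val + e := by
        rw [← Nat.div_add_mod (m * a.val + d) N, h3]
        dsimp only at h2
        rw [h2, Nat.div_add_mod]
      have h5 : a.val = b.val := by
        have := congrArg (· / m) h4
        simpa [Nat.mul_add_div hm, Nat.div_eq_of_lt hd, Nat.div_eq_of_lt he] using this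
      have h6 : d = e := by
        rw [h5] at h4
        exact Nat.add_left_cancel h4
      rw [ZMod.val_injective N h5, h6]
  rw [ncard_prod, ncard_prod] at h
  have hc : (Iio m : Set ℕ).ncard = m := by simp [← Finset.coe_Iio, ncard_coe_finset]
  rw [hc] at h
  exact Nat.le_of_mul_le_mul_right h hm

lemma ncard_le_ncard_iterate_indexStep (hm : 0 < m) (n : ℕ) (A : Set (ZMod N)) :
    A.ncard ≤ ((indexStep m N σ)^[n] A).ncard := by
  induction n generalizing A with
  | zero => rfl
  | succ n ih =>
    rw [Function.iterate_succ_apply]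
    refine le_trans ?_ (ih _)
    rw [indexStep, ncard_image_of_injective _ σ.injective]
    exact ncard_le_ncard_ftil hm A

lemma topMixing_permMul_iff (hm : 2 ≤ m) :
    TopMixing (permMul m N σ) ↔ ∀ j, ∃ n, (indexStep m N σ)^[n] {j} = univ := by
  have hm0 : 0 < m := by omega
  constructor
  · intro h j
    obtain ⟨U, hU, hUne, hUj⟩ := exists_isOpen_subset_subIndex_preimage j
    choose V hV hVne hVb using exists_isOpen_subset_subIndex_preimage (N := N)
    choose n₀ hn₀ using fun b => h U (V b) hU (hV b) hUne (hVne b)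
    refine ⟨Finset.univ.sup n₀, eq_univ_of_forall fun b => ?_⟩
    obtain ⟨y, hy, hyb⟩ := hn₀ b _ (Finset.le_sup (Finset.mem_univ b))
    have hy' := image_mono hUj hy
    rw [iterate_permMul_image_subIndex_preimage σ hm0, mem_preimage, hVb b hyb] at hy'
    exact hy'
  · intro h U V hU _ hUne ⟨v, hv⟩
    obtain ⟨k, j, hk⟩ := hU.exists_subIndex_preimage_subset_iterate_image σ hm hUne
    obtain ⟨n, hn⟩ := h j
    refine ⟨n + k, fun r hr => ⟨v, ?_, hv⟩⟩
    obtain ⟨i, rfl⟩ := Nat.exists_eq_add_of_le hr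
    have hi : (indexStep m N σ)^[i + n] {j} = univ := by
      rw [Function.iterate_add_apply, hn, Function.iterate_fixed (indexStep_univ σ hm0)]
    have hv' : v ∈ (permMul m N σ)^[i + n] '' (subIndex N ⁻¹' {j}) := by
      rw [iterate_permMul_image_subIndex_preimage σ hm0, hi]
      trivial
    have := image_mono hk hv'
    rwa [← image_comp, ← Function.iterate_add, show i + n + k = n + k + i by omega] at this

lemma exists_iterate_indexStep_eq_univ (hm : 0 < m)
    (h : ∀ A : Set (ZMod N), A.Nonempty → A ≠ univ →
      ∃ r, ((indexStep m N σ)^[r] A).ncard ≠ A.ncard)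
    (A : Set (ZMod N)) (hA : A.Nonempty) : ∃ n, (indexStep m N σ)^[n] A = univ := by
  induction hk : N - A.ncard using Nat.strong_induction_on generalizing A with
  | _ k ih =>
    by_cases hu : A = univ
    · exact ⟨0, hu⟩
    obtain ⟨r, hr⟩ := h A hA hu
    have hlt := lt_of_le_of_ne (ncard_le_ncard_iterate_indexStep σ hm r A) hr.symm
    have hAN : A.ncard < N := by
      have := ncard_lt_card hu
      rwa [Nat.card_zmod] at this
    obtain ⟨n, hn⟩ := ih _ (by omega) ((indexStep m N σ)^[r] A)
      (nonempty_of_ncard_ne_zero (by omega)) rfl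
    exact ⟨n + r, by rw [Function.iterate_add_apply, hn]⟩

end Dynamics

/-- `g = σ ∘ f` fails to be topologically mixing iff there is a nonempty
proper subset `A` of `ℤ/Nℤ` with `♯(g̃^r(A)) = ♯A` for all `r ≥ 0`. -/
theorem stmt6 (m N : ℕ) (hm : 2 ≤ m) (hN : 2 ≤ N) (σ : Equiv.Perm (ZMod N)) :
    (¬ TopMixing (fun x => permMap N σ (mulMap m x))) ↔
      ∃ A : Set (ZMod N), A.Nonempty ∧ A ≠ Set.univ ∧
        ∀ r : ℕ, ((fun B => ⇑σ '' ftil m N B)^[r] A).ncard = A.ncard := by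
  have : NeZero N := ⟨by omega⟩
  change ¬ TopMixing (permMul m N σ) ↔ ∃ A : Set (ZMod N), A.Nonempty ∧ A ≠ univ ∧
    ∀ r, ((indexStep m N σ)^[r] A).ncard = A.ncard
  have hm0 : 0 < m := by omega
  rw [topMixing_permMul_iff σ hm]
  constructor
  · contrapose!
    exact fun h j => exists_iterate_indexStep_eq_univ σ hm0 h {j} (singleton_nonempty j)
  · rintro ⟨A, ⟨a, ha⟩, hA, hr⟩ h
    obtain ⟨n, hn⟩ := h a
    have hle : univ ⊆ (indexStep m N σ)^[n] A :=
      hn.ge.trans ((indexStep_mono σ).iterate n (singleton_subset_iff.2 ha))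
    have hc := hr n
    rw [univ_subset_iff.1 hle, ncard_univ] at hc
    exact (ncard_lt_card hA).ne hc.symm
end

section
/- Let m ≥ 2, ℓ ≥ 1 and N = mℓ. There exists a permutation δ of ℤ/Nℤ such that f(I_j) ⊇ I_{δ(j)} for all j ∈ ℤ/Nℤ. Moreover, for any such δ, any permutation σ of ℤ/Nℤ, and any subset A ⊆ ℤ/Nℤ, the following are equivalent: (i) ♯g̃(A) = ♯A; (ii) A is a union of cosets of the subgroup ℓℤ/Nℤ of ℤ/Nℤ; (iii) (σ∘δ)(A) = g̃(A). -/
open Set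

/-- If `I_b` lies in the image of `I_j`, then `b` belongs to the block of `m` residues
starting at `m j`. -/
theorem eq_mul_add_of_Isub_subset {m N : ℕ} [NeZero N] (hm : 0 < m) {b j : ZMod N}
    (h : Isub N b ⊆ (fun x => mulMap m x) '' Isub N j) :
    ∃ d : ℕ, d < m ∧ b = (m : ZMod N) * j + (d : ZMod N) := by
  have hN : (0 : ℝ) < N := by exact_mod_cast NeZero.pos N
  have hm' : (0 : ℝ) < m := by exact_mod_cast hm
  have hb : (b.val : ℝ) < N := by exact_mod_cast ZMod.val_lt b
  obtain ⟨y, ⟨hy1, hy2⟩, hy⟩ := h (show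
    (⟨(b.val : ℝ) / N, by positivity, (div_lt_one hN).2 hb⟩ : Set.Ico (0 : ℝ) 1) ∈ Isub N b from
      ⟨le_rfl, div_lt_div_of_pos_right (lt_add_one _) hN⟩)
  have hy' : Int.fract ((m : ℝ) * y.val) = (b.val : ℝ) / N := congrArg Subtype.val hy
  rw [Int.fract, eq_div_iff hN.ne'] at hy'
  rw [div_le_iff₀ hN] at hy1
  rw [lt_div_iff₀ hN] at hy2
  generalize ⌊(m : ℝ) * y.val⌋ = k at hy'
  have hlo : (m * j.val : ℤ) ≤ b.val + k * N := by
    have : (m : ℝ) * j.val ≤ b.val + k * N := by nlinarith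
    exact_mod_cast this
  have hhi : (b.val + k * N : ℤ) < m * j.val + m := by
    have : (b.val : ℝ) + k * N < m * j.val + m := by nlinarith
    exact_mod_cast this
  obtain ⟨d, hd⟩ := Int.le.dest hlo
  refine ⟨d, by omega, ?_⟩
  have := congrArg (Int.cast : ℤ → ZMod N) hd
  push_cast at this
  simpa using this.symm

theorem val_div_lt {m ℓ N : ℕ} [NeZero N] (hN : N = m * ℓ) (j : ZMod N) : j.val / ℓ < m :=
  Nat.div_lt_of_lt_mul ((ZMod.val_lt j).trans_eq (hN.trans (mul_comm m ℓ)))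

/-- The image of `I_j` under `x ↦ m x mod 1` contains `I_b`, where `j = q ℓ + r` and
`b = m r + q`. -/
theorem Isub_subset_image_mulMap {m ℓ N : ℕ} [NeZero N] (hN : N = m * ℓ) {b j : ZMod N}
    (hb : b.val = m * (j.val % ℓ) + j.val / ℓ) :
    Isub N b ⊆ (fun x => mulMap m x) '' Isub N j := by
  have hNpos : (0 : ℝ) < N := by exact_mod_cast NeZero.pos N
  have hm : 0 < m := Nat.pos_of_ne_zero fun h => NeZero.ne N (by simp [hN, h])
  have hm' : (0 : ℝ) < m := by exact_mod_cast hm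
  have hNr : (N : ℝ) = m * ℓ := by exact_mod_cast hN
  have hj : (j.val : ℝ) = ℓ * (j.val / ℓ : ℕ) + (j.val % ℓ : ℕ) := by
    exact_mod_cast (Nat.div_add_mod j.val ℓ).symm
  have hb' : (b.val : ℝ) = m * (j.val % ℓ : ℕ) + (j.val / ℓ : ℕ) := by exact_mod_cast hb
  have hq : ((j.val / ℓ : ℕ) : ℝ) + 1 ≤ m := by
    exact_mod_cast val_div_lt hN j
  generalize j.val / ℓ = q at *
  generalize j.val % ℓ = r at *
  rintro ⟨x, hx0, hx1⟩ ⟨h1, h2⟩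
  simp only at h1 h2
  rw [div_le_iff₀ hNpos, hb'] at h1
  rw [lt_div_iff₀ hNpos, hb'] at h2
  have hq0 : (0 : ℝ) ≤ q := Nat.cast_nonneg q
  refine ⟨⟨(x + q) / m, by positivity, (div_lt_one hm').2 (by linarith)⟩, ⟨?_, ?_⟩, ?_⟩
  · change (j.val : ℝ) / N ≤ (x + q) / m
    rw [div_le_div_iff₀ hNpos hm', hj]
    nlinarith
  · change (x + q) / m < ((j.val : ℝ) + 1) / N
    rw [div_lt_div_iff₀ hm' hNpos, hj]
    nlinarith
  · apply Subtype.ext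
    change Int.fract ((m : ℝ) * ((x + q) / m)) = x
    rw [mul_div_cancel₀ _ hm'.ne', Int.fract_add_natCast]
    exact Int.fract_eq_self.2 ⟨hx0, hx1⟩

/-- The interleaving `q ℓ + r ↦ m r + q` is a permutation of `ℤ/mℓℤ`. -/
theorem exists_perm_val_eq {m ℓ N : ℕ} [NeZero N] (hN : N = m * ℓ) :
    ∃ δ : Equiv.Perm (ZMod N), ∀ j, (δ j).val = m * (j.val % ℓ) + j.val / ℓ := by
  have hl : 0 < ℓ := Nat.pos_of_ne_zero fun h => NeZero.ne N (by simp [hN, h])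
  have hq (j : ZMod N) : j.val / ℓ < m := val_div_lt hN j
  have hval (j : ZMod N) :
      ((m * (j.val % ℓ) + j.val / ℓ : ℕ) : ZMod N).val = m * (j.val % ℓ) + j.val / ℓ := by
    apply ZMod.val_cast_of_lt
    have hr : j.val % ℓ < ℓ := Nat.mod_lt _ hl
    have := hq j
    refine lt_of_lt_of_eq ?_ hN.symm
    nlinarith
  have hinj : Function.Injective
      fun j : ZMod N => ((m * (j.val % ℓ) + j.val / ℓ : ℕ) : ZMod N) := by
    intro i j hij
    have h := congrArg ZMod.val hij
    simp only [hval] at h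
    have hm : 0 < m := (Nat.zero_le _).trans_lt (hq i)
    have hdiv : i.val / ℓ = j.val / ℓ := by
      have := congrArg (· % m) h
      simpa [Nat.mul_add_mod, Nat.mod_eq_of_lt (hq _)] using this
    have hmod : i.val % ℓ = j.val % ℓ := by
      rw [hdiv] at h
      exact Nat.eq_of_mul_eq_mul_left hm (Nat.add_right_cancel h)
    apply ZMod.val_injective N
    rw [← Nat.div_add_mod i.val ℓ, ← Nat.div_add_mod j.val ℓ, hdiv, hmod]
  exact ⟨Equiv.ofBijective _ (Finite.injective_iff_bijective.1 hinj), hval⟩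

/-- The representation `m a + d` with `0 ≤ d < m` determines `a` modulo `ℓ`. -/
theorem exists_eq_add_mul_of_mul_add_eq {m ℓ N : ℕ} [NeZero N] (hN : N = m * ℓ)
    {a j : ZMod N} {d e : ℕ} (hd : d < m) (he : e < m)
    (h : (m : ZMod N) * a + d = (m : ZMod N) * j + e) :
    ∃ k : ℕ, j = a + k * (ℓ : ZMod N) := by
  have hde : d = e := by
    have hmN : m ∣ N := ⟨ℓ, hN⟩
    have := congrArg (ZMod.castHom hmN (ZMod m)) h
    simp only [map_add, map_mul, map_natCast, CharP.cast_eq_zero, zero_mul, zero_add] at this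
    rwa [ZMod.natCast_eq_natCast_iff', Nat.mod_eq_of_lt hd, Nat.mod_eq_of_lt he] at this
  subst hde
  have h0 : (m : ZMod N) * (j - a) = 0 := by
    rw [mul_sub, sub_eq_zero]
    exact (add_right_cancel h).symm
  have hdvd : N ∣ m * (j - a).val := by
    rw [← ZMod.natCast_eq_zero_iff]
    simpa using h0
  obtain ⟨k, hk⟩ := Nat.dvd_of_mul_dvd_mul_left (Nat.zero_lt_of_lt hd) (hN.symm.dvd.trans hdvd)
  refine ⟨k, ?_⟩
  have := congrArg (Nat.cast : ℕ → ZMod N) hk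
  rw [ZMod.natCast_zmod_val] at this
  push_cast at this
  linear_combination this

/-- For a permutation `δ` selecting a point of each block, `δ(A)` fills up `f̃(A)` exactly when
`A` is invariant under translation by `ℓ`. -/
theorem image_eq_ftil_iff {m ℓ N : ℕ} [NeZero N] (hN : N = m * ℓ) {δ : Equiv.Perm (ZMod N)}
    (hδ : ∀ j, ∃ d : ℕ, d < m ∧ δ j = (m : ZMod N) * j + (d : ZMod N)) (A : Set (ZMod N)) :
    δ '' A = ftil m N A ↔ ∀ j ∈ A, j + (ℓ : ZMod N) ∈ A := by
  constructor
  · intro h j hj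
    obtain ⟨d, hd, hδj⟩ := hδ (j + ℓ)
    have hmem : δ (j + ℓ) ∈ ftil m N A := by
      refine ⟨j, hj, d, hd, ?_⟩
      have hml : (m : ZMod N) * ℓ = 0 := by
        rw [← Nat.cast_mul, ← hN, ZMod.natCast_self]
      rw [hδj, mul_add, hml, add_zero]
    rw [← h] at hmem
    exact δ.injective.mem_set_image.1 hmem
  · intro h
    have hmul (k : ℕ) {a : ZMod N} (ha : a ∈ A) : a + k * (ℓ : ZMod N) ∈ A := by
      induction k with
      | zero => simpa using ha
      | succ k ih =>
        have := h _ ih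
        rwa [add_assoc, ← add_one_mul, ← Nat.cast_succ] at this
    apply Subset.antisymm
    · rintro _ ⟨j, hj, rfl⟩
      obtain ⟨d, hd, hδj⟩ := hδ j
      exact ⟨j, hj, d, hd, hδj⟩
    · rintro b ⟨a, ha, d, hd, hb⟩
      obtain ⟨e, he, hδj⟩ := hδ (δ.symm b)
      rw [Equiv.apply_symm_apply] at hδj
      obtain ⟨k, hk⟩ := exists_eq_add_mul_of_mul_add_eq hN hd he (hb.symm.trans hδj)
      exact ⟨δ.symm b, hk ▸ hmul k ha, δ.apply_symm_apply b⟩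

/-- existence of `δ` with `f(I_j) ⊇ I_{δ(j)}`, and for any such `δ`, any
`σ` and any `A ⊆ ℤ/Nℤ`, the equivalence of (i) `♯g̃(A) = ♯A`, (ii) `A` is a union of
cosets of `ℓℤ/Nℤ`, (iii) `(σ∘δ)(A) = g̃(A)`. -/
theorem stmt7 (m ℓ N : ℕ) (hm : 2 ≤ m) (hl : 1 ≤ ℓ) (hN : N = m * ℓ) :
    (∃ δ : Equiv.Perm (ZMod N),
        ∀ j : ZMod N, Isub N (δ j) ⊆ (fun x => mulMap m x) '' Isub N j) ∧
    (∀ δ : Equiv.Perm (ZMod N),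
      (∀ j : ZMod N, Isub N (δ j) ⊆ (fun x => mulMap m x) '' Isub N j) →
      ∀ (σ : Equiv.Perm (ZMod N)) (A : Set (ZMod N)),
        ((⇑σ '' ftil m N A).ncard = A.ncard ↔
          ∀ j : ZMod N, j ∈ A → j + (ℓ : ZMod N) ∈ A) ∧
        ((⇑σ '' ftil m N A).ncard = A.ncard ↔
          ⇑(σ * δ) '' A = ⇑σ '' ftil m N A)) := by
  have : NeZero N := ⟨by rw [hN]; positivity⟩
  refine ⟨?_, fun δ hδI σ A => ?_⟩
  · obtain ⟨δ, hδ⟩ := exists_perm_val_eq hN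
    exact ⟨δ, fun j => Isub_subset_image_mulMap hN (hδ j)⟩
  have hδ (j : ZMod N) := eq_mul_add_of_Isub_subset (by omega) (hδI j)
  have hsub : δ '' A ⊆ ftil m N A := by
    rintro _ ⟨j, hj, rfl⟩
    obtain ⟨d, hd, hδj⟩ := hδ j
    exact ⟨j, hj, d, hd, hδj⟩
  have hcard : (⇑σ '' ftil m N A).ncard = A.ncard ↔ δ '' A = ftil m N A := by
    rw [ncard_image_of_injective _ σ.injective, ← ncard_image_of_injective A δ.injective]
    exact ⟨fun h => eq_of_subset_of_ncard_le hsub h.le (toFinite _), fun h => by rw [h]⟩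
  refine ⟨hcard.trans (image_eq_ftil_iff hN hδ A), hcard.trans ?_⟩
  rw [Equiv.Perm.coe_mul, image_comp, σ.injective.image_injective.eq_iff]
end
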